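/- arXiv:2507.13763 — 6 statements merged into one kernel-verified Lean document; each statement's English description precedes it below -/
import Mathlib

section
/- Let P be a convex-ranged probability charge on an algebra Σ and let v : Σ → ℝ be a P-invariant game. (i) If sup LA_v exists in ba (setwise order), then sup LA_v = a·P for some constant a ∈ ℝ. (ii) If sup A_v exists in ba, then sup A_v = â·P for some constant â ∈ ℝ. (iii) If inf LC_v exists in ba, then inf LC_v = b·P for some constant b ∈ ℝ. (iv) If inf C_v exists in ba, then inf C_v = b̂·P for some constant b̂ ∈ ℝ. -/
/-- A bounded signed charge on the algebra `S` of subsets of `Ω`: a finitely additive,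
bounded real-valued set function, normalised to vanish outside `S`. -/
structure Charge {Ω : Type*} (S : Set (Set Ω)) where
  toFun : Set Ω → ℝ
  zero_of_not_mem : ∀ A : Set Ω, A ∉ S → toFun A = 0
  additive : ∀ A B : Set Ω, A ∈ S → B ∈ S → Disjoint A B → toFun (A ∪ B) = toFun A + toFun B
  bounded : ∃ C : ℝ, ∀ A : Set Ω, |toFun A| ≤ C

namespace Charge

variable {Ω : Type*} {S : Set (Set Ω)}

theorem ext' {μ ν : Charge S} (h : μ.toFun = ν.toFun) : μ = ν := by
  cases μ; cases ν; simpa using h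

noncomputable instance : SMul ℝ (Charge S) :=
  ⟨fun a μ =>
    { toFun := fun A => a * μ.toFun A
      zero_of_not_mem := fun A hA => by
        show a * μ.toFun A = 0
        rw [μ.zero_of_not_mem A hA, mul_zero]
      additive := fun A B hA hB hAB => by
        show a * μ.toFun (A ∪ B) = a * μ.toFun A + a * μ.toFun B
        rw [μ.additive A B hA hB hAB]; ring
      bounded := by
        obtain ⟨C, hC⟩ := μ.bounded
        refine ⟨|a| * C, fun A => ?_⟩
        show |a * μ.toFun A| ≤ |a| * C
        rw [abs_mul]
        exact mul_le_mul_of_nonneg_left (hC A) (abs_nonneg a) }⟩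

@[simp] theorem smul_toFun (a : ℝ) (μ : Charge S) (A : Set Ω) :
    (a • μ).toFun A = a * μ.toFun A := rfl

/-- The setwise (partial) order on bounded charges. -/
instance : PartialOrder (Charge S) where
  le μ ν := ∀ A ∈ S, μ.toFun A ≤ ν.toFun A
  le_refl μ A _ := le_refl _
  le_trans μ ν ξ h1 h2 A hA := le_trans (h1 A hA) (h2 A hA)
  le_antisymm μ ν h1 h2 := ext' (funext fun A => by
    by_cases hA : A ∈ S
    · exact le_antisymm (h1 A hA) (h2 A hA)
    · rw [μ.zero_of_not_mem A hA, ν.zero_of_not_mem A hA])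

theorem le_def {μ ν : Charge S} : μ ≤ ν ↔ ∀ A ∈ S, μ.toFun A ≤ ν.toFun A := Iff.rfl

end Charge

/-- A probability charge: nonnegative, with total mass one. -/
def IsProbCharge {Ω : Type*} {S : Set (Set Ω)} (P : Charge S) : Prop :=
  P.toFun Set.univ = 1 ∧ ∀ A : Set Ω, 0 ≤ P.toFun A

/-- A charge `P` has convex range if for every `A ∈ S` the set of values `P(B)`,
`B ∈ S`, `B ⊆ A`, is the full interval `[0, P(A)]`. -/
def HasConvexRange {Ω : Type*} {S : Set (Set Ω)} (P : Charge S) : Prop :=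
  ∀ A ∈ S, {x : ℝ | ∃ B ∈ S, B ⊆ A ∧ P.toFun B = x} = Set.Icc 0 (P.toFun A)

/-- The loose anticore of a set function `v`. -/
def LooseAnticore {Ω : Type*} {S : Set (Set Ω)} (v : Set Ω → ℝ) : Set (Charge S) :=
  {μ | ∀ A ∈ S, μ.toFun A ≤ v A}

/-- The anticore of a set function `v`. -/
def Anticore {Ω : Type*} {S : Set (Set Ω)} (v : Set Ω → ℝ) : Set (Charge S) :=
  {μ | μ ∈ LooseAnticore v ∧ μ.toFun Set.univ = v Set.univ}

/-- The loose core of a set function `v`. -/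
def LooseCore {Ω : Type*} {S : Set (Set Ω)} (v : Set Ω → ℝ) : Set (Charge S) :=
  {μ | ∀ A ∈ S, v A ≤ μ.toFun A}

/-- The core of a set function `v`. -/
def Core {Ω : Type*} {S : Set (Set Ω)} (v : Set Ω → ℝ) : Set (Charge S) :=
  {μ | μ ∈ LooseCore v ∧ μ.toFun Set.univ = v Set.univ}

namespace Charge

variable {Ω : Type*} {S : Set (Set Ω)}

theorem toFun_diff (hS : MeasureTheory.IsSetAlgebra S) (μ : Charge S) {A B : Set Ω}
    (hA : A ∈ S) (hB : B ∈ S) (hBA : B ⊆ A) : μ.toFun (A \ B) = μ.toFun A - μ.toFun B := by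
  have h := μ.additive B (A \ B) hB (hS.sdiff_mem hA hB) Set.disjoint_sdiff_right
  rw [Set.union_sdiff_cancel hBA] at h
  linarith

theorem toFun_add_compl (hS : MeasureTheory.IsSetAlgebra S) (μ : Charge S) {A : Set Ω}
    (hA : A ∈ S) : μ.toFun A + μ.toFun Aᶜ = μ.toFun Set.univ := by
  rw [← μ.additive A Aᶜ hA (hS.compl_mem hA) disjoint_compl_right, Set.union_compl_self]

theorem toFun_inter_add_inter_compl (hS : MeasureTheory.IsSetAlgebra S) (μ : Charge S)
    {A B : Set Ω} (hA : A ∈ S) (hB : B ∈ S) :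
    μ.toFun (A ∩ B) + μ.toFun (A ∩ Bᶜ) = μ.toFun A := by
  rw [← μ.additive (A ∩ B) (A ∩ Bᶜ) (hS.inter_mem hA hB) (hS.inter_mem hA (hS.compl_mem hB))
    (disjoint_compl_right.mono Set.inter_subset_right Set.inter_subset_right),
    Set.inter_union_compl]

open Classical in
/-- The charge with `P`-density `a` on `B` and `b` on the complement of `B`. -/
noncomputable def twoStep (hS : MeasureTheory.IsSetAlgebra S) (P : Charge S) {B : Set Ω}
    (hB : B ∈ S) (a b : ℝ) : Charge S where
  toFun C := if C ∈ S then a * P.toFun (C ∩ B) + b * P.toFun (C ∩ Bᶜ) else 0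
  zero_of_not_mem C hC := if_neg hC
  additive C D hC hD hCD := by
    have hB' := hS.compl_mem hB
    rw [if_pos hC, if_pos hD, if_pos (hS.union_mem hC hD), Set.union_inter_distrib_right,
      Set.union_inter_distrib_right,
      P.additive _ _ (hS.inter_mem hC hB) (hS.inter_mem hD hB)
        (hCD.mono Set.inter_subset_left Set.inter_subset_left),
      P.additive _ _ (hS.inter_mem hC hB') (hS.inter_mem hD hB')
        (hCD.mono Set.inter_subset_left Set.inter_subset_left)]
    ring
  bounded := by
    obtain ⟨M, hM⟩ := P.bounded
    have hM0 : 0 ≤ M := (abs_nonneg _).trans (hM ∅)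
    refine ⟨|a| * M + |b| * M, fun C => ?_⟩
    split_ifs with hC
    · refine (abs_add_le _ _).trans (add_le_add ?_ ?_) <;> rw [abs_mul] <;> gcongr <;> exact hM _
    · rw [abs_zero]
      positivity

theorem twoStep_toFun (hS : MeasureTheory.IsSetAlgebra S) (P : Charge S) {B : Set Ω}
    (hB : B ∈ S) (a b : ℝ) {C : Set Ω} (hC : C ∈ S) :
    (twoStep hS P hB a b).toFun C = a * P.toFun (C ∩ B) + b * P.toFun (C ∩ Bᶜ) := if_pos hC

end Charge

section ConvexRange

variable {Ω : Type*} {S : Set (Set Ω)} {P : Charge S}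

theorem HasConvexRange.exists_subset (h : HasConvexRange P) {A : Set Ω} (hA : A ∈ S) {x : ℝ}
    (hx0 : 0 ≤ x) (hx : x ≤ P.toFun A) : ∃ B ∈ S, B ⊆ A ∧ P.toFun B = x :=
  (h A hA).symm.subset ⟨hx0, hx⟩

/-- Some `k`-th part of `A` has at most average `μ`-value. -/
theorem HasConvexRange.exists_part_le (hS : MeasureTheory.IsSetAlgebra S)
    (hP : ∀ A, 0 ≤ P.toFun A) (h : HasConvexRange P) (μ : Charge S) (k : ℕ) :
    ∀ A ∈ S, ∃ C ∈ S, C ⊆ A ∧ (k + 1) * P.toFun C = P.toFun A ∧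
      (k + 1) * μ.toFun C ≤ μ.toFun A := by
  induction k with
  | zero => exact fun A hA => ⟨A, hA, subset_rfl, by simp, by simp⟩
  | succ k ih =>
    intro A hA
    push_cast
    have hk : (0 : ℝ) < k + 1 + 1 := by positivity
    obtain ⟨D, hD, hDA, hPD⟩ := h.exists_subset hA (x := P.toFun A / (k + 1 + 1))
      (div_nonneg (hP A) hk.le) (div_le_self (hP A) (by linarith [(k.cast_nonneg : (0 : ℝ) ≤ k)]))
    rw [eq_div_iff hk.ne'] at hPD
    by_cases hμ : (k + 1 + 1) * μ.toFun D ≤ μ.toFun A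
    · exact ⟨D, hD, hDA, by linarith, hμ⟩
    · obtain ⟨C, hC, hCD, hPC, hμC⟩ := ih (A \ D) (hS.sdiff_mem hA hD)
      rw [Charge.toFun_diff hS _ hA hD hDA] at hPC hμC
      have hk1 : (0 : ℝ) < k + 1 := by positivity
      refine ⟨C, hC, hCD.trans Set.sdiff_subset, ?_, ?_⟩
      · have : P.toFun C = P.toFun D := by
          apply mul_left_cancel₀ hk1.ne'
          linarith
        rw [this]; linarith
      · have : μ.toFun C ≤ μ.toFun D := by
          apply le_of_mul_le_mul_left _ hk1
          linarith
        linarith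

/-- Some union of `m` out of `m + j` equal parts of `A` has at least average `μ`-value. -/
theorem HasConvexRange.exists_rat_ge (hS : MeasureTheory.IsSetAlgebra S)
    (hP : ∀ A, 0 ≤ P.toFun A) (h : HasConvexRange P) (μ : Charge S) {A : Set Ω} (hA : A ∈ S)
    {N : ℕ} (j : ℕ) : ∀ m : ℕ, m + j = N → ∃ B ∈ S, B ⊆ A ∧ N * P.toFun B = m * P.toFun A ∧
      m * μ.toFun A ≤ N * μ.toFun B := by
  induction j with
  | zero => rintro m rfl; exact ⟨A, hA, subset_rfl, by simp, by simp⟩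
  | succ j ih =>
    intro m hm
    obtain ⟨B, hB, hBA, hPB, hμB⟩ := ih (m + 1) (by omega)
    obtain ⟨C, hC, hCB, hPC, hμC⟩ := h.exists_part_le hS hP μ m B hB
    push_cast at hPB hμB
    have hm1 : (0 : ℝ) < m + 1 := by positivity
    refine ⟨B \ C, hS.sdiff_mem hB hC, Set.sdiff_subset.trans hBA, ?_, ?_⟩ <;>
      rw [Charge.toFun_diff hS _ hB hC hCB]
    · have : N * P.toFun C = P.toFun A := by
        apply mul_left_cancel₀ hm1.ne'
        linear_combination N * hPC + hPB
      linear_combination hPB - this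
    · apply le_of_mul_le_mul_left _ hm1
      have h1 := mul_le_mul_of_nonneg_left hμC N.cast_nonneg
      have h2 := mul_le_mul_of_nonneg_left hμB m.cast_nonneg
      linarith

/-- Every value `x ≤ P A` is attained by a subset of `A` whose `μ`-value is, up to `ε`, at least
its proportional share of `μ A`. -/
theorem HasConvexRange.exists_ge (hS : MeasureTheory.IsSetAlgebra S)
    (hP : ∀ A, 0 ≤ P.toFun A) (h : HasConvexRange P) (μ : Charge S) {A : Set Ω} (hA : A ∈ S)
    {x ε : ℝ} (hx0 : 0 ≤ x) (hx : x ≤ P.toFun A) (hε : 0 < ε) :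
    ∃ B ∈ S, B ⊆ A ∧ P.toFun B = x ∧ μ.toFun A / P.toFun A * x ≤ μ.toFun B + ε := by
  rcases hx.eq_or_lt with rfl | hlt
  · rcases hx0.eq_or_lt with h0 | h0
    · have hz (ν : Charge S) : ν.toFun ∅ = 0 := by
        simpa using ν.toFun_diff hS hA hA subset_rfl
      exact ⟨∅, hS.empty_mem, Set.empty_subset _, by rw [hz, ← h0],
        by rw [hz, ← h0]; linarith⟩
    · exact ⟨A, hA, subset_rfl, rfl, by rw [div_mul_cancel₀ _ h0.ne']; linarith⟩
  have hp : 0 < P.toFun A := hx0.trans_lt hlt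
  obtain ⟨θ, hθ⟩ : ∃ θ, θ = x / P.toFun A := ⟨_, rfl⟩
  have hθx : x = θ * P.toFun A := by rw [hθ, div_mul_cancel₀ _ hp.ne']
  have hθ0 : 0 ≤ θ := hθ ▸ div_nonneg hx0 hp.le
  have hθ1 : θ < 1 := by rw [hθ, div_lt_one hp]; exact hlt
  obtain ⟨M, hM⟩ := μ.bounded
  obtain ⟨N, hN⟩ := exists_nat_gt (2 * M / ((1 - θ) * ε))
  have hM0 : 0 ≤ M := (abs_nonneg _).trans (hM ∅)
  have hd : 0 < (1 - θ) * ε := mul_pos (sub_pos.2 hθ1) hε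
  have hN0 : (0 : ℝ) < N := (div_nonneg (by linarith) hd.le).trans_lt hN
  rw [div_lt_iff₀ hd] at hN
  have hm := Nat.floor_le (mul_nonneg hθ0 hN0.le)
  have hm' := Nat.lt_floor_add_one (θ * N)
  obtain ⟨m, hmdef⟩ : ∃ m, m = ⌊θ * N⌋₊ := ⟨_, rfl⟩
  rw [← hmdef] at hm hm'
  have hmN : m < N := by
    have : (m : ℝ) < N := hm.trans_lt (by nlinarith)
    exact_mod_cast this
  obtain ⟨k, hk⟩ := Nat.exists_eq_add_of_lt hmN
  have hkR : (N : ℝ) = m + (k + 1) := by rw [hk]; push_cast; ring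
  have hk0 : (0 : ℝ) < k + 1 := by positivity
  have hkε : 2 * M ≤ (k + 1) * ε := by
    have : (1 - θ) * N ≤ k + 1 := by linarith
    nlinarith
  obtain ⟨E, hE, hEA, hPE, hμE⟩ := h.exists_rat_ge hS hP μ hA (N := N) (k + 1) m (by omega)
  have hPF := P.toFun_diff hS hA hE hEA
  have hr : N * (x - P.toFun E) = (θ * N - m) * P.toFun A := by
    rw [hθx]; linear_combination -hPE
  have hr0 : 0 ≤ x - P.toFun E :=
    nonneg_of_mul_nonneg_right (hr ▸ mul_nonneg (by linarith) hp.le) hN0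
  have hr1 : (k + 1) * (x - P.toFun E) ≤ P.toFun (A \ E) := by
    apply le_of_mul_le_mul_left _ hN0
    have h1 : N * P.toFun (A \ E) = (k + 1) * P.toFun A := by
      rw [hPF]; linear_combination P.toFun A * hkR - hPE
    have h2 : (θ * N - m) * P.toFun A ≤ P.toFun A := by nlinarith
    rw [h1]
    calc _ = (k + 1) * (N * (x - P.toFun E)) := by ring
      _ ≤ _ := by rw [hr]; exact mul_le_mul_of_nonneg_left h2 hk0.le
  obtain ⟨F, hF, hFA, hPF'⟩ := h.exists_subset (hS.sdiff_mem hA hE) (mul_nonneg hk0.le hr0) hr1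
  obtain ⟨G, hG, hGF, hPG, hμG⟩ := h.exists_part_le hS hP ((-1 : ℝ) • μ) k F hF
  simp only [Charge.smul_toFun] at hμG
  have hPG' : P.toFun G = x - P.toFun E := mul_left_cancel₀ hk0.ne' (hPG.trans hPF')
  have hEG : Disjoint E G := Set.disjoint_sdiff_right.mono_right (hGF.trans hFA)
  refine ⟨E ∪ G, hS.union_mem hE hG,
    Set.union_subset hEA ((hGF.trans hFA).trans Set.sdiff_subset), ?_, ?_⟩
  · rw [P.additive _ _ hE hG hEG, hPG']; ring
  · rw [μ.additive _ _ hE hG hEG]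
    have h1 : -(ε / 2) ≤ μ.toFun G := by
      apply le_of_mul_le_mul_left _ hk0
      linarith [(abs_le.1 (hM F)).1]
    have h2 : θ * μ.toFun A - ε / 2 ≤ μ.toFun E := by
      apply le_of_mul_le_mul_left _ hN0
      have h3 : (θ * N - m) * μ.toFun A ≤ M := by
        have := abs_le.1 (hM A)
        nlinarith
      have h4 : 2 * M ≤ N * ε := by
        have : (0 : ℝ) ≤ m * ε := by positivity
        rw [hkR]; linarith
      linarith
    have h5 : μ.toFun A / P.toFun A * x = θ * μ.toFun A := by rw [hθ]; ring
    linarith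

theorem HasConvexRange.exists_looseAnticore_ge (hS : MeasureTheory.IsSetAlgebra S)
    (hP : IsProbCharge P) (h : HasConvexRange P) {v : Set Ω → ℝ} (hv0 : v ∅ = 0)
    (hv : ∀ A ∈ S, ∀ B ∈ S, P.toFun A = P.toFun B → v A = v B)
    {μ : Charge S} (hμ : μ ∈ LooseAnticore v) {A B : Set Ω} (hA : A ∈ S) (hB : B ∈ S)
    (hAB : P.toFun A = P.toFun B) :
    ∃ ν : Charge S, ν ∈ LooseAnticore v ∧ μ.toFun A ≤ ν.toFun B ∧
      (μ.toFun Set.univ = v Set.univ → ν.toFun Set.univ = v Set.univ) := by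
  have hz (ν : Charge S) : ν.toFun ∅ = 0 := by
    simpa using ν.toFun_diff hS hA hA subset_rfl
  have hA' := hS.compl_mem hA
  have hB' := hS.compl_mem hB
  have hPc : P.toFun Aᶜ = P.toFun Bᶜ := by
    linarith [P.toFun_add_compl hS hA, P.toFun_add_compl hS hB]
  have hnull {C : Set Ω} (hC : C ∈ S) (h0 : P.toFun C = 0) : μ.toFun C ≤ 0 := by
    rw [← hv0, ← hv C hC ∅ hS.empty_mem (by rw [h0, hz])]
    exact hμ C hC
  have hnull' {C : Set Ω} (hC : C ∈ S) (h0 : P.toFun C = 0)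
      (hu : μ.toFun Set.univ = v Set.univ) : μ.toFun C = 0 := by
    have h1 := μ.toFun_add_compl hS hC
    have h2 := hμ _ (hS.compl_mem hC)
    rw [hv _ (hS.compl_mem hC) _ hS.univ_mem (by linarith [P.toFun_add_compl hS hC])] at h2
    linarith [hnull hC h0]
  refine ⟨Charge.twoStep hS P hB (μ.toFun A / P.toFun A) (μ.toFun Aᶜ / P.toFun Aᶜ), ?_, ?_, ?_⟩
  · intro C hC
    rw [Charge.twoStep_toFun hS P hB _ _ hC]
    refine le_of_forall_pos_le_add fun ε hε => ?_
    have hle {D : Set Ω} (hD : D ∈ S) : P.toFun (C ∩ D) ≤ P.toFun D := by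
      have := P.toFun_inter_add_inter_compl hS hD hC
      rw [Set.inter_comm] at this
      linarith [hP.2 (D ∩ Cᶜ)]
    obtain ⟨E, hE, hEA, hPE, hμE⟩ := h.exists_ge hS hP.2 μ hA (hP.2 (C ∩ B))
      ((hle hB).trans_eq hAB.symm) (half_pos hε)
    obtain ⟨F, hF, hFA, hPF, hμF⟩ := h.exists_ge hS hP.2 μ hA' (hP.2 (C ∩ Bᶜ))
      ((hle hB').trans_eq hPc.symm) (half_pos hε)
    have hEF : Disjoint E F := disjoint_compl_right.mono hEA hFA
    have hEFS := hS.union_mem hE hF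
    have h1 := hμ _ hEFS
    rw [μ.additive _ _ hE hF hEF, hv _ hEFS C hC (by
      rw [P.additive _ _ hE hF hEF, hPE, hPF, P.toFun_inter_add_inter_compl hS hC hB])] at h1
    linarith
  · rw [Charge.twoStep_toFun hS P hB _ _ hB, Set.inter_self, Set.inter_compl_self, hz, mul_zero,
      add_zero, ← hAB]
    rcases eq_or_ne (P.toFun A) 0 with h0 | h0
    · simpa [h0] using hnull hA h0
    · rw [div_mul_cancel₀ _ h0]
  · intro hu
    rw [Charge.twoStep_toFun hS P hB _ _ hS.univ_mem, Set.univ_inter, Set.univ_inter, ← hAB, ← hPc,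
      div_mul_cancel_of_imp fun h0 => hnull' hA h0 hu,
      div_mul_cancel_of_imp fun h0 => hnull' hA' h0 hu, μ.toFun_add_compl hS hA, hu]

/-- The least upper bound of a set of charges whose upper values depend on `P` only is a multiple
of `P`. -/
theorem HasConvexRange.isLUB_eq_smul (hS : MeasureTheory.IsSetAlgebra S)
    (hP : IsProbCharge P) (h : HasConvexRange P) {D : Set (Charge S)}
    (hD : ∀ μ ∈ D, ∀ A ∈ S, ∀ B ∈ S, P.toFun A = P.toFun B → ∃ ν ∈ D, μ.toFun A ≤ ν.toFun B)
    {s : Charge S} (hs : IsLUB D s) : s = s.toFun Set.univ • P := by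
  have hub : s ≤ s.toFun Set.univ • P := by
    refine hs.2 fun μ hμ A hA => le_of_forall_pos_le_add fun ε hε => ?_
    have hA1 : P.toFun A ≤ P.toFun Set.univ := by
      linarith [P.toFun_add_compl hS hA, hP.2 Aᶜ]
    obtain ⟨B, hB, -, hPB, hsB⟩ := h.exists_ge hS hP.2 ((-1 : ℝ) • s) hS.univ_mem (hP.2 A) hA1 hε
    obtain ⟨ν, hν, hμν⟩ := hD μ hμ A hA B hB hPB.symm
    have := hs.1 hν B hB
    simp only [Charge.smul_toFun, hP.1, div_one] at hsB ⊢
    linarith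
  refine le_antisymm hub fun A hA => ?_
  have h1 := hub _ (hS.compl_mem hA)
  have h2 := s.toFun_add_compl hS hA
  have h3 := P.toFun_add_compl hS hA
  rw [hP.1] at h3
  simp only [Charge.smul_toFun] at h1 ⊢
  rw [← eq_sub_iff_add_eq'] at h3
  rw [h3] at h1
  linarith

theorem HasConvexRange.isLUB_looseAnticore (hS : MeasureTheory.IsSetAlgebra S)
    (hP : IsProbCharge P) (h : HasConvexRange P) {v : Set Ω → ℝ} (hv0 : v ∅ = 0)
    (hv : ∀ A ∈ S, ∀ B ∈ S, P.toFun A = P.toFun B → v A = v B) {s : Charge S}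
    (hs : IsLUB (LooseAnticore v) s) : ∃ a : ℝ, s = a • P := by
  refine ⟨_, h.isLUB_eq_smul hS hP (fun μ hμ A hA B hB hAB => ?_) hs⟩
  obtain ⟨ν, hν, hle, -⟩ := h.exists_looseAnticore_ge hS hP hv0 hv hμ hA hB hAB
  exact ⟨ν, hν, hle⟩

theorem HasConvexRange.isLUB_anticore (hS : MeasureTheory.IsSetAlgebra S)
    (hP : IsProbCharge P) (h : HasConvexRange P) {v : Set Ω → ℝ} (hv0 : v ∅ = 0)
    (hv : ∀ A ∈ S, ∀ B ∈ S, P.toFun A = P.toFun B → v A = v B) {s : Charge S}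
    (hs : IsLUB (Anticore v) s) : ∃ a : ℝ, s = a • P := by
  refine ⟨_, h.isLUB_eq_smul hS hP (fun μ hμ A hA B hB hAB => ?_) hs⟩
  obtain ⟨ν, hν, hle, hu⟩ := h.exists_looseAnticore_ge hS hP hv0 hv hμ.1 hA hB hAB
  exact ⟨ν, ⟨hν, hu hμ.2⟩, hle⟩

end ConvexRange

namespace Charge

variable {Ω : Type*} {S : Set (Set Ω)}

theorem isLUB_of_isGLB {D E : Set (Charge S)} (hDE : ∀ μ ∈ D, (-1 : ℝ) • μ ∈ E)
    (hED : ∀ μ ∈ E, (-1 : ℝ) • μ ∈ D) {s : Charge S} (hs : IsGLB D s) :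
    IsLUB E ((-1 : ℝ) • s) := by
  refine ⟨fun μ hμ A hA => ?_, fun t ht A hA => ?_⟩
  · have := hs.1 (hED μ hμ) A hA
    simp only [smul_toFun] at this ⊢
    linarith
  · have hlb : (-1 : ℝ) • t ∈ lowerBounds D := fun μ hμ B hB => by
      have := ht (hDE μ hμ) B hB
      simp only [smul_toFun] at this ⊢
      linarith
    have := hs.2 hlb A hA
    simp only [smul_toFun] at this ⊢
    linarith

theorem eq_neg_smul {s P : Charge S} {a : ℝ} (h : (-1 : ℝ) • s = a • P) : s = (-a) • P :=
  ext' <| funext fun A => by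
    have := congrFun (congrArg toFun h) A
    simp only [smul_toFun] at this ⊢
    linarith

theorem neg_mem_looseAnticore {v : Set Ω → ℝ} {μ : Charge S} (hμ : μ ∈ LooseCore v) :
    (-1 : ℝ) • μ ∈ LooseAnticore (-v) := fun A hA => by
  have := hμ A hA
  simp only [smul_toFun, Pi.neg_apply]
  linarith

theorem neg_mem_looseCore {v : Set Ω → ℝ} {μ : Charge S} (hμ : μ ∈ LooseAnticore (-v)) :
    (-1 : ℝ) • μ ∈ LooseCore v := fun A hA => by
  have := hμ A hA
  simp only [smul_toFun, Pi.neg_apply] at this ⊢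
  linarith

end Charge

/-- Let `P` be a convex-ranged probability charge on an algebra `S` and let
`v` be a `P`-invariant game. If the supremum (in the setwise order on `ba`) of the loose
anticore, respectively the anticore, exists, it is a scalar multiple of `P`; likewise the
infimum of the loose core, respectively the core, is a scalar multiple of `P` if it exists. -/
theorem stmt6 {Ω : Type*} (S : Set (Set Ω)) (hS : MeasureTheory.IsSetAlgebra S)
    (P : Charge S) (hP : IsProbCharge P) (hPcr : HasConvexRange P)
    (v : Set Ω → ℝ) (hv0 : v ∅ = 0)
    (hvinv : ∀ A ∈ S, ∀ B ∈ S, P.toFun A = P.toFun B → v A = v B) :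
    (∀ s : Charge S, IsLUB (LooseAnticore v) s → ∃ a : ℝ, s = a • P) ∧
    (∀ s : Charge S, IsLUB (Anticore v) s → ∃ ahat : ℝ, s = ahat • P) ∧
    (∀ s : Charge S, IsGLB (LooseCore v) s → ∃ b : ℝ, s = b • P) ∧
    (∀ s : Charge S, IsGLB (Core v) s → ∃ bhat : ℝ, s = bhat • P) := by
  have hv0' : (-v) ∅ = 0 := by simp [hv0]
  have hv' : ∀ A ∈ S, ∀ B ∈ S, P.toFun A = P.toFun B → (-v) A = (-v) B :=
    fun A hA B hB hAB => congrArg Neg.neg (hvinv A hA B hB hAB)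
  refine ⟨fun s hs => hPcr.isLUB_looseAnticore hS hP hv0 hvinv hs,
    fun s hs => hPcr.isLUB_anticore hS hP hv0 hvinv hs, fun s hs => ?_, fun s hs => ?_⟩
  · obtain ⟨a, ha⟩ := hPcr.isLUB_looseAnticore hS hP hv0' hv'
      (Charge.isLUB_of_isGLB (fun μ hμ => Charge.neg_mem_looseAnticore hμ)
        (fun μ hμ => Charge.neg_mem_looseCore hμ) hs)
    exact ⟨-a, Charge.eq_neg_smul ha⟩
  · obtain ⟨a, ha⟩ := hPcr.isLUB_anticore hS hP hv0' hv'
      (Charge.isLUB_of_isGLB (D := Core v) (E := Anticore (-v))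
        (fun μ hμ => ⟨Charge.neg_mem_looseAnticore hμ.1, by simp [hμ.2]⟩)
        (fun μ hμ => ⟨Charge.neg_mem_looseCore hμ.1, by simp [hμ.2]⟩) hs)
    exact ⟨-a, Charge.eq_neg_smul ha⟩
end

section
/- Let Σ be a σ-algebra, ℙ an atomless probability measure on Σ, and v = h∘ℙ a nonnegative ℙ-invariant game on Σ (so h : [0,1] → [0,∞) with h(0) = 0 and v(A) = h(ℙ(A))). If inf_{0 < x ≤ 1} h(x) > 0, then the core C_v and the σ-core C_v^σ are both empty, and neither sup LA_v (in ba) nor sup LA_v^σ (in ca) exists. -/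
/-- The measurable sets of a measurable space, as a set algebra. -/
def MSets (Ω : Type*) [MeasurableSpace Ω] : Set (Set Ω) := {A : Set Ω | MeasurableSet A}

/-- A charge is countably additive if it is σ-additive on pairwise disjoint sequences of
members of `S`. -/
def CountablyAdditive {Ω : Type*} {S : Set (Set Ω)} (μ : Charge S) : Prop :=
  ∀ f : ℕ → Set Ω, (∀ n, f n ∈ S) → (Pairwise fun m n => Disjoint (f m) (f n)) →
    (⋃ n, f n) ∈ S → HasSum (fun n => μ.toFun (f n)) (μ.toFun (⋃ n, f n))

/-- Atomlessness of a nonnegative charge. -/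
def AtomlessCharge {Ω : Type*} {S : Set (Set Ω)} (P : Charge S) : Prop :=
  ∀ A ∈ S, 0 < P.toFun A → ∃ B ∈ S, B ⊆ A ∧ 0 < P.toFun B ∧ P.toFun B < P.toFun A

/-- Sup-transfer property between `ba` and `ca`: the supremum of `Y` exists in `ba` iff the
supremum of its countably additive part exists in `ca`; in that case both are equal to a
scalar multiple of `P` and lie in `ca`. -/
def SupTransfer {Ω : Type*} {S : Set (Set Ω)} (Y : Set (Charge S)) (P : Charge S) : Prop :=
  ((∃ s : Charge S, IsLUB Y s) ↔
    (∃ s : {μ : Charge S // CountablyAdditive μ},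
      IsLUB {ν : {μ : Charge S // CountablyAdditive μ} | ν.1 ∈ Y} s)) ∧
  ∀ s : Charge S, IsLUB Y s → ∃ a : ℝ, s = a • P ∧
    ∃ hs : CountablyAdditive s,
      IsLUB {ν : {μ : Charge S // CountablyAdditive μ} | ν.1 ∈ Y} ⟨s, hs⟩

/-- Inf-transfer property between `ba` and `ca`, analogous to `SupTransfer`. -/
def InfTransfer {Ω : Type*} {S : Set (Set Ω)} (Y : Set (Charge S)) (P : Charge S) : Prop :=
  ((∃ s : Charge S, IsGLB Y s) ↔
    (∃ s : {μ : Charge S // CountablyAdditive μ},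
      IsGLB {ν : {μ : Charge S // CountablyAdditive μ} | ν.1 ∈ Y} s)) ∧
  ∀ s : Charge S, IsGLB Y s → ∃ b : ℝ, s = b • P ∧
    ∃ hs : CountablyAdditive s,
      IsGLB {ν : {μ : Charge S // CountablyAdditive μ} | ν.1 ∈ Y} ⟨s, hs⟩

namespace Charge

variable {Ω : Type*} [MeasurableSpace Ω]

open Classical in
/-- The restriction of a charge to a measurable set `B`. -/
noncomputable def restrict (P : Charge (MSets Ω)) (B : Set Ω) (hB : MeasurableSet B) :
    Charge (MSets Ω) where
  toFun A := if MeasurableSet A then P.toFun (A ∩ B) else 0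
  zero_of_not_mem A hA := if_neg hA
  additive A A' hA hA' hAA' := by
    have hA : MeasurableSet A := hA
    have hA' : MeasurableSet A' := hA'
    rw [if_pos hA, if_pos hA', if_pos (hA.union hA'), Set.union_inter_distrib_right]
    exact P.additive _ _ (hA.inter hB) (hA'.inter hB)
      (hAA'.mono Set.inter_subset_left Set.inter_subset_left)
  bounded := by
    obtain ⟨C, hC⟩ := P.bounded
    refine ⟨C, fun A => ?_⟩
    split_ifs
    · exact hC _
    · simpa using (abs_nonneg _).trans (hC ∅)

theorem restrict_toFun (P : Charge (MSets Ω)) {A B : Set Ω} (hB : MeasurableSet B)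
    (hA : MeasurableSet A) : (P.restrict B hB).toFun A = P.toFun (A ∩ B) :=
  if_pos hA

theorem countablyAdditive_smul_restrict {P : Charge (MSets Ω)} (hP : CountablyAdditive P)
    (a : ℝ) {B : Set Ω} (hB : MeasurableSet B) : CountablyAdditive (a • P.restrict B hB) := by
  intro f hf hd hU
  simp only [smul_toFun]
  have hU' : (P.restrict B hB).toFun (⋃ n, f n) = P.toFun (⋃ n, f n ∩ B) := by
    rw [restrict_toFun P hB hU, Set.iUnion_inter]
  have hf' : ∀ n, (P.restrict B hB).toFun (f n) = P.toFun (f n ∩ B) := fun n =>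
    restrict_toFun P hB (hf n)
  simp only [hU', hf']
  have hm : ∀ n, MeasurableSet (f n ∩ B) := fun n => MeasurableSet.inter (hf n) hB
  exact (hP (fun n => f n ∩ B) hm
    (fun m n hmn => (hd hmn).mono Set.inter_subset_left Set.inter_subset_left)
    (MeasurableSet.iUnion hm)).mul_left a

theorem toFun_add_diff (μ : Charge (MSets Ω)) {A B : Set Ω} (hA : MeasurableSet A)
    (hB : MeasurableSet B) (hBA : B ⊆ A) : μ.toFun A = μ.toFun B + μ.toFun (A \ B) := by
  rw [← μ.additive B (A \ B) hB (hA.diff hB) Set.disjoint_sdiff_right,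
    Set.union_sdiff_cancel hBA]

theorem toFun_mono {P : Charge (MSets Ω)} (hP : IsProbCharge P) {A B : Set Ω}
    (hA : MeasurableSet A) (hB : MeasurableSet B) (hBA : B ⊆ A) : P.toFun B ≤ P.toFun A := by
  have := P.toFun_add_diff hA hB hBA
  linarith [hP.2 (A \ B)]

/-- No bounded charge is bounded away from zero on all the sets that are not null for an
atomless probability charge. -/
theorem not_forall_pos_le {P : Charge (MSets Ω)} (hP : IsProbCharge P) (hPa : AtomlessCharge P)
    {c : ℝ} (hc : 0 < c) (s : Charge (MSets Ω)) :
    ¬ ∀ B, MeasurableSet B → 0 < P.toFun B → c ≤ s.toFun B := by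
  intro hs
  have key : ∀ n : ℕ, ∀ B, MeasurableSet B → 0 < P.toFun B → n * c ≤ s.toFun B := by
    intro n
    induction n with
    | zero => intro B hB hPB; simpa using hc.le.trans (hs B hB hPB)
    | succ n ih =>
      intro B hB hPB
      obtain ⟨D, hD, hDB, hD0, hD1⟩ := hPa B hB hPB
      have hP' := P.toFun_add_diff hB hD hDB
      have hs' := s.toFun_add_diff hB hD hDB
      have h1 := ih D hD hD0
      have h2 := hs (B \ D) (hB.diff hD) (by linarith)
      push_cast
      linarith
  obtain ⟨C, hC⟩ := s.bounded
  obtain ⟨n, hn⟩ := exists_nat_gt (C / c)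
  have h1 := key n Set.univ MeasurableSet.univ (by rw [hP.1]; exact one_pos)
  rw [div_lt_iff₀ hc] at hn
  linarith [(le_abs_self _).trans (hC Set.univ)]

end Charge

/-- Let `P` be an atomless countably additive probability charge on a
σ-algebra and `v = h ∘ P` a nonnegative `P`-invariant game with `inf_{0 < x ≤ 1} h(x) > 0`.
Then the core and the σ-core are empty, and neither the supremum of the loose anticore in
`ba` nor the supremum of the loose σ-anticore in `ca` exists. -/
theorem stmt7 {Ω : Type*} [MeasurableSpace Ω]
    (P : Charge (MSets Ω)) (hPca : CountablyAdditive P) (hPprob : IsProbCharge P)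
    (hPatomless : AtomlessCharge P)
    (h : ℝ → ℝ) (hh0 : h 0 = 0) (hhnonneg : ∀ x ∈ Set.Icc (0 : ℝ) 1, 0 ≤ h x)
    (v : Set Ω → ℝ) (hv : ∀ A ∈ MSets Ω, v A = h (P.toFun A)) (hv0 : v ∅ = 0)
    (hvnonneg : ∀ A ∈ MSets Ω, 0 ≤ v A)
    (hinf : 0 < sInf (h '' Set.Ioc (0 : ℝ) 1)) :
    (Core v : Set (Charge (MSets Ω))) = ∅ ∧
    {ν : {μ : Charge (MSets Ω) // CountablyAdditive μ} | ν.1 ∈ Core v} = ∅ ∧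
    (¬ ∃ s : Charge (MSets Ω), IsLUB (LooseAnticore v) s) ∧
    (¬ ∃ s : {μ : Charge (MSets Ω) // CountablyAdditive μ},
      IsLUB {ν : {μ : Charge (MSets Ω) // CountablyAdditive μ} | ν.1 ∈ LooseAnticore v} s) := by
  set c := sInf (h '' Set.Ioc (0 : ℝ) 1)
  have hle : ∀ B, MeasurableSet B → 0 < P.toFun B → c ≤ v B := by
    intro B hB hPB
    rw [hv B hB]
    refine csInf_le ⟨0, ?_⟩ ⟨_, ⟨hPB, ?_⟩, rfl⟩
    · rintro _ ⟨x, hx, rfl⟩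
      exact hhnonneg x ⟨hx.1.le, hx.2⟩
    · exact (Charge.toFun_mono hPprob MeasurableSet.univ hB (Set.subset_univ B)).trans_eq
        hPprob.1
  have hcore : ∀ μ : Charge (MSets Ω), μ ∉ Core v := fun μ hμ =>
    Charge.not_forall_pos_le hPprob hPatomless hinf μ fun B hB hPB =>
      (hle B hB hPB).trans (hμ.1 B hB)
  have hcond : ∀ B (hB : MeasurableSet B), 0 < P.toFun B →
      (c / P.toFun B) • P.restrict B hB ∈ LooseAnticore v := by
    intro B hB hPB A hA
    have hAB : MeasurableSet (A ∩ B) := MeasurableSet.inter hA hB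
    rw [Charge.smul_toFun, Charge.restrict_toFun P hB hA, div_mul_eq_mul_div, div_le_iff₀ hPB]
    have h1 := Charge.toFun_mono hPprob hB hAB Set.inter_subset_right
    have h2 := Charge.toFun_mono hPprob hA hAB Set.inter_subset_left
    rcases (hPprob.2 A).eq_or_lt with h0 | h0
    · have h3 : P.toFun (A ∩ B) = 0 := le_antisymm (h2.trans h0.ge) (hPprob.2 _)
      rw [h3, mul_zero]
      exact mul_nonneg (hvnonneg A hA) hPB.le
    · exact mul_le_mul (hle A hA h0) h1 (hPprob.2 _) (hvnonneg A hA)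
  have hval : ∀ B (hB : MeasurableSet B), 0 < P.toFun B →
      ((c / P.toFun B) • P.restrict B hB).toFun B = c := by
    intro B hB hPB
    rw [Charge.smul_toFun, Charge.restrict_toFun P hB hB, Set.inter_self,
      div_mul_cancel₀ _ hPB.ne']
  refine ⟨Set.eq_empty_of_forall_notMem hcore,
    Set.eq_empty_of_forall_notMem fun μ => hcore μ.1, ?_, ?_⟩
  · rintro ⟨s, hs⟩
    refine Charge.not_forall_pos_le hPprob hPatomless hinf s fun B hB hPB => ?_
    exact (hval B hB hPB).ge.trans (hs.1 (hcond B hB hPB) B hB)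
  · rintro ⟨s, hs⟩
    refine Charge.not_forall_pos_le hPprob hPatomless hinf s.1 fun B hB hPB => ?_
    have hle' := hs.1 (show (⟨(c / P.toFun B) • P.restrict B hB,
      Charge.countablyAdditive_smul_restrict hPca _ hB⟩ :
        {μ : Charge (MSets Ω) // CountablyAdditive μ}) ∈ _ from hcond B hB hPB)
    exact (hval B hB hPB).ge.trans (hle' B hB)
end

section
/- Let P be a convex-ranged probability charge on an algebra Σ, let α > 0, and define the game v_α(A) = (1/α)·log((e^α − 1)·P(A) + 1) for A ∈ Σ. Then sup A_{v_α}, sup LA_{v_α}, and inf LC_{v_α} all exist in ba (setwise order) and sup A_{v_α} = sup LA_{v_α} = inf LC_{v_α} = ((e^α − 1)/α)·P. -/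
namespace Charge

variable {Ω : Type*} {S : Set (Set Ω)}

/-- The charge `C ↦ a * P (C ∩ B) + b * P (C \ B)`. -/
noncomputable def piecewise (hS : MeasureTheory.IsSetAlgebra S) (P : Charge S) {B : Set Ω} (hB : B ∈ S)
    (a b : ℝ) : Charge S := by
  classical
  exact
  { toFun := fun C => if C ∈ S then a * P.toFun (C ∩ B) + b * P.toFun (C \ B) else 0
    zero_of_not_mem := fun C hC => if_neg hC
    additive := fun C D hC hD hCD => by
      rw [if_pos hC, if_pos hD, if_pos (hS.union_mem hC hD), Set.union_inter_distrib_right,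
        Set.union_sdiff_distrib,
        P.additive _ _ (hS.inter_mem hC hB) (hS.inter_mem hD hB)
          (hCD.mono Set.inter_subset_left Set.inter_subset_left),
        P.additive _ _ (hS.sdiff_mem hC hB) (hS.sdiff_mem hD hB)
          (hCD.mono Set.sdiff_subset Set.sdiff_subset)]
      ring
    bounded := by
      obtain ⟨K, hK⟩ := P.bounded
      refine ⟨|a| * K + |b| * K, fun C => ?_⟩
      split_ifs
      · calc |a * P.toFun (C ∩ B) + b * P.toFun (C \ B)|
            ≤ |a| * |P.toFun (C ∩ B)| + |b| * |P.toFun (C \ B)| := by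
              simpa only [abs_mul] using
                abs_add_le (a * P.toFun (C ∩ B)) (b * P.toFun (C \ B))
          _ ≤ |a| * K + |b| * K := by gcongr <;> exact hK _
      · have hK0 : 0 ≤ K := (abs_nonneg _).trans (hK ∅)
        rw [abs_zero]
        positivity }

theorem piecewise_toFun (hS : MeasureTheory.IsSetAlgebra S) (P : Charge S) {B C : Set Ω}
    (hB : B ∈ S) (hC : C ∈ S) (a b : ℝ) :
    (piecewise hS P hB a b).toFun C = a * P.toFun (C ∩ B) + b * P.toFun (C \ B) :=
  if_pos hC

theorem inter_add_sdiff (hS : MeasureTheory.IsSetAlgebra S) (P : Charge S) {B C : Set Ω}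
    (hB : B ∈ S) (hC : C ∈ S) : P.toFun (C ∩ B) + P.toFun (C \ B) = P.toFun C := by
  rw [← P.additive _ _ (hS.inter_mem hC hB) (hS.sdiff_mem hC hB)
    (Set.disjoint_sdiff_inter.symm), Set.inter_union_sdiff]

theorem toFun_empty (hS : MeasureTheory.IsSetAlgebra S) (P : Charge S) : P.toFun ∅ = 0 := by
  have h := inter_add_sdiff hS P hS.empty_mem hS.empty_mem
  simp only [Set.inter_self, Set.sdiff_self] at h
  linarith

end Charge

/-- A concave function vanishing at `0` lies above its chord from `0`. -/
theorem ConcaveOn.mul_le_of_le {f : ℝ → ℝ} (hf : ConcaveOn ℝ (Set.Icc 0 1) f) (h0 : f 0 = 0)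
    {t z : ℝ} (ht : t ≤ 1) (hz : 0 ≤ z) (hzt : z ≤ t) : f t / t * z ≤ f z := by
  rcases hz.eq_or_lt with rfl | hz'
  · simp [h0]
  have ht0 : 0 < t := hz'.trans_le hzt
  have h := hf.2 (Set.left_mem_Icc.2 zero_le_one) (show t ∈ Set.Icc 0 1 from ⟨ht0.le, ht⟩)
    (sub_nonneg.2 ((div_le_one ht0).2 hzt)) (div_nonneg hz ht0.le) (by ring)
  simp only [smul_eq_mul, h0, mul_zero, zero_add, div_mul_cancel₀ _ ht0.ne'] at h
  calc f t / t * z = z / t * f t := by ring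
    _ ≤ f z := h

/-- A concave function lies above its chord to `1`. -/
theorem ConcaveOn.add_mul_le_of_ge {f : ℝ → ℝ} (hf : ConcaveOn ℝ (Set.Icc 0 1) f)
    {t z : ℝ} (ht : 0 ≤ t) (htz : t ≤ z) (hz : z ≤ 1) :
    f t + (f 1 - f t) / (1 - t) * (z - t) ≤ f z := by
  rcases htz.eq_or_lt with rfl | htz'
  · simp
  have ht1 : 0 < 1 - t := by linarith
  have h := hf.2 (show t ∈ Set.Icc 0 1 from ⟨ht, by linarith⟩)
    (Set.right_mem_Icc.2 zero_le_one)
    (sub_nonneg.2 ((div_le_one ht1).2 (sub_le_sub_right hz t)))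
    (div_nonneg (sub_nonneg.2 htz) ht1.le) (by ring)
  have e : (1 - (z - t) / (1 - t)) * t + (z - t) / (1 - t) * 1 = z := by
    field_simp
    ring
  simp only [smul_eq_mul, e] at h
  calc f t + (f 1 - f t) / (1 - t) * (z - t)
      = (1 - (z - t) / (1 - t)) * f t + (z - t) / (1 - t) * f 1 := by ring
    _ ≤ f z := h

theorem ConcaveOn.two_chords_le {f : ℝ → ℝ} (hf : ConcaveOn ℝ (Set.Icc 0 1) f) (h0 : f 0 = 0)
    {t x y : ℝ} (hx : 0 ≤ x) (hxt : x ≤ t) (hy : 0 ≤ y) (hyt : y ≤ 1 - t) :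
    f t / t * x + (f 1 - f t) / (1 - t) * y ≤ f (x + y) := by
  have ht0 : 0 ≤ t := hx.trans hxt
  have ht1 : t ≤ 1 := by linarith
  rcases ht0.eq_or_lt with rfl | ht0'
  · obtain rfl : x = 0 := le_antisymm hxt hx
    simpa [h0] using hf.mul_le_of_le h0 le_rfl hy (by linarith)
  rcases ht1.eq_or_lt with rfl | ht1'
  · obtain rfl : y = 0 := by linarith
    simpa using hf.mul_le_of_le h0 le_rfl hx hxt
  have hab : (f 1 - f t) / (1 - t) ≤ f t / t := by
    have h := hf.mul_le_of_le h0 le_rfl ht0 ht1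
    rw [div_le_div_iff₀ (by linarith) ht0']
    linarith
  rcases le_total (x + y) t with h | h
  · have h1 := hf.mul_le_of_le h0 ht1 (by positivity) h
    nlinarith [mul_le_mul_of_nonneg_right hab hy]
  · have h1 := hf.add_mul_le_of_ge ht0 h (by linarith)
    have h2 : f t / t * t = f t := div_mul_cancel₀ _ ht0'.ne'
    nlinarith [mul_le_mul_of_nonneg_right hab (sub_nonneg.2 hxt)]

section

variable {Ω : Type*} {S : Set (Set Ω)}

/-- A concave distortion of a probability charge is the upper envelope of its anticore. -/
theorem exists_mem_anticore_toFun_eq (hS : MeasureTheory.IsSetAlgebra S) {P : Charge S}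
    (hP : IsProbCharge P) {f : ℝ → ℝ} (hf : ConcaveOn ℝ (Set.Icc 0 1) f) (h0 : f 0 = 0)
    {B : Set Ω} (hB : B ∈ S) :
    ∃ μ ∈ (Anticore (fun A => f (P.toFun A)) : Set (Charge S)), μ.toFun B = f (P.toFun B) := by
  have hU := hS.univ_mem
  have hBc := P.inter_add_sdiff hS hB hU
  rw [hP.1, Set.univ_inter] at hBc
  have hBe : f (P.toFun B) / P.toFun B * P.toFun B = f (P.toFun B) :=
    div_mul_cancel_of_imp fun h => by rw [h, h0]
  refine ⟨P.piecewise hS hB (f (P.toFun B) / P.toFun B)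
    ((f 1 - f (P.toFun B)) / (1 - P.toFun B)), ⟨fun C hC => ?_, ?_⟩, ?_⟩
  · have h1 := P.inter_add_sdiff hS hC hB
    have h2 := P.inter_add_sdiff hS hC (hS.sdiff_mem hU hB)
    have h3 : Set.univ \ B ∩ C = C \ B := by ext; simp [and_comm]
    have h4 := hP.2 (B \ C)
    have h5 := hP.2 ((Set.univ \ B) \ C)
    rw [Set.inter_comm] at h1
    rw [h3] at h2
    rw [P.piecewise_toFun hS hB hC]
    show _ ≤ f (P.toFun C)
    rw [← P.inter_add_sdiff hS hB hC]
    exact hf.two_chords_le h0 (hP.2 _) (by linarith) (hP.2 _) (by linarith)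
  · show _ = f (P.toFun Set.univ)
    rw [P.piecewise_toFun hS hB hU, Set.univ_inter, hBe, hP.1, eq_sub_of_add_eq' hBc,
      div_mul_cancel_of_imp fun h => by rw [← sub_eq_zero.1 h, sub_self]]
    ring
  · rw [P.piecewise_toFun hS hB hB, Set.inter_self, Set.sdiff_self, P.toFun_empty hS, hBe]
    ring

theorem nsmul_le_of_mem_looseCore (hS : MeasureTheory.IsSetAlgebra S) {P : Charge S}
    (hPcr : HasConvexRange P) {f : ℝ → ℝ} (h0 : f 0 = 0) {ξ : Charge S}
    (hξ : ξ ∈ (LooseCore (fun A => f (P.toFun A)) : Set (Charge S))) {s : ℝ} (hs : 0 ≤ s)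
    (n : ℕ) {A : Set Ω} (hA : A ∈ S) (hn : P.toFun A = n * s) : n * f s ≤ ξ.toFun A := by
  induction n generalizing A with
  | zero =>
    have h : f (P.toFun A) ≤ ξ.toFun A := hξ A hA
    rw [hn] at h
    simpa [h0] using h
  | succ n ih =>
    push_cast at hn ⊢
    have hsA : s ∈ Set.Icc 0 (P.toFun A) := ⟨hs, by rw [hn]; nlinarith [n.cast_nonneg (α := ℝ)]⟩
    rw [← hPcr A hA] at hsA
    obtain ⟨B, hB, hBA, hBs⟩ := hsA
    have h1 := P.inter_add_sdiff hS hB hA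
    have h2 := ξ.inter_add_sdiff hS hB hA
    rw [Set.inter_eq_right.2 hBA] at h1 h2
    have h3 := ih (hS.sdiff_mem hA hB) (by linarith)
    have h4 : f (P.toFun B) ≤ ξ.toFun B := hξ B hB
    rw [hBs] at h4
    linarith

end

theorem concaveOn_mul_log_one_add {c k : ℝ} (hc : 0 ≤ c) (hk : 0 ≤ k) :
    ConcaveOn ℝ (Set.Icc 0 1) fun x => c * Real.log (k * x + 1) := by
  refine ConcaveOn.smul (f := fun x => Real.log (k * x + 1)) hc ⟨convex_Icc 0 1, ?_⟩
  intro x hx y hy a b ha hb hab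
  have h := strictConcaveOn_log_Ioi.concaveOn.2
    (Set.mem_Ioi.2 (add_pos_of_nonneg_of_pos (mul_nonneg hk hx.1) one_pos))
    (Set.mem_Ioi.2 (add_pos_of_nonneg_of_pos (mul_nonneg hk hy.1) one_pos)) ha hb hab
  refine h.trans_eq (congrArg Real.log ?_)
  simp only [smul_eq_mul]
  linear_combination hab

/-- For the entropic game `v_α(A) = (1/α)·log((e^α − 1)·P(A) + 1)`
associated with a convex-ranged probability charge `P` and a parameter `α > 0`, the suprema
of the anticore and of the loose anticore and the infimum of the loose core all exist in
`ba` (setwise order) and coincide with `((e^α − 1)/α)·P`. -/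
theorem stmt10 {Ω : Type*} (S : Set (Set Ω)) (hS : MeasureTheory.IsSetAlgebra S)
    (P : Charge S) (hP : IsProbCharge P) (hPcr : HasConvexRange P)
    (α : ℝ) (hα : 0 < α) :
    IsLUB (Anticore (fun A => α⁻¹ * Real.log ((Real.exp α - 1) * P.toFun A + 1)) :
        Set (Charge S)) (((Real.exp α - 1) / α) • P) ∧
    IsLUB (LooseAnticore (fun A => α⁻¹ * Real.log ((Real.exp α - 1) * P.toFun A + 1)) :
        Set (Charge S)) (((Real.exp α - 1) / α) • P) ∧
    IsGLB (LooseCore (fun A => α⁻¹ * Real.log ((Real.exp α - 1) * P.toFun A + 1)) :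
        Set (Charge S)) (((Real.exp α - 1) / α) • P) := by
  set k : ℝ := Real.exp α - 1 with hk
  have hk0 : 0 ≤ k := by rw [hk]; linarith [Real.one_le_exp hα.le]
  have hf := concaveOn_mul_log_one_add (inv_nonneg.2 hα.le) hk0
  have h0 : α⁻¹ * Real.log (k * 0 + 1) = 0 := by simp
  have hle (A : Set Ω) : α⁻¹ * Real.log (k * P.toFun A + 1) ≤ k / α * P.toFun A := by
    have hpos : 0 ≤ k * P.toFun A := mul_nonneg hk0 (hP.2 A)
    have h := Real.log_le_sub_one_of_pos (x := k * P.toFun A + 1) (by linarith)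
    calc α⁻¹ * Real.log (k * P.toFun A + 1) ≤ α⁻¹ * (k * P.toFun A) := by
          gcongr
          linarith
      _ = k / α * P.toFun A := by ring
  have hcore : ∀ ξ ∈ (LooseCore (fun A => α⁻¹ * Real.log (k * P.toFun A + 1)) : Set (Charge S)),
      (k / α) • P ≤ ξ := by
    intro ξ hξ A hA
    have hlim := (Real.tendsto_mul_log_one_add_div_atTop (k * P.toFun A)).comp
      (tendsto_natCast_atTop_atTop (R := ℝ))
    have hlim' := hlim.const_mul α⁻¹
    rw [Charge.smul_toFun, show k / α * P.toFun A = α⁻¹ * (k * P.toFun A) by ring]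
    refine le_of_tendsto hlim' ?_
    filter_upwards [Filter.eventually_gt_atTop 0] with n hn
    have hn' : (0 : ℝ) < n := Nat.cast_pos.2 hn
    have h := nsmul_le_of_mem_looseCore hS hPcr
      (f := fun x => α⁻¹ * Real.log (k * x + 1)) h0 hξ
      (s := P.toFun A / n) (div_nonneg (hP.2 A) hn'.le) n hA (by field_simp)
    refine le_trans (le_of_eq ?_) h
    simp only [Function.comp_apply]
    rw [mul_div_assoc, add_comm (1 : ℝ)]
    ring
  have hanti : ∀ ξ ∈ upperBounds
      (Anticore (fun A => α⁻¹ * Real.log (k * P.toFun A + 1)) : Set (Charge S)),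
      (k / α) • P ≤ ξ := by
    refine fun ξ hξ => hcore ξ fun B hB => ?_
    obtain ⟨μ, hμ, hμB⟩ := exists_mem_anticore_toFun_eq hS hP hf h0 hB
    exact hμB.symm.le.trans (hξ hμ B hB)
  refine ⟨⟨fun μ hμ A hA => (hμ.1 A hA).trans (hle A), hanti⟩,
    ⟨fun μ hμ A hA => (hμ A hA).trans (hle A), fun ξ hξ => hanti ξ fun μ hμ => hξ hμ.1⟩,
    ⟨hcore, fun ξ hξ => hξ fun A _ => hle A⟩⟩
end

section
/- Let P be a convex-ranged probability charge on an algebra Σ, let γ ∈ (0,1), and define the game v_γ(A) = 1 if P(A) > 1 − γ and v_γ(A) = 0 otherwise. Then sup LA_{v_γ} and inf LC_{v_γ} both exist in ba (setwise order) and sup LA_{v_γ} = 0 and inf LC_{v_γ} = 0 (the zero charge). -/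
/-- The zero charge. -/
instance {Ω : Type*} {S : Set (Set Ω)} : Zero (Charge S) :=
  ⟨{ toFun := fun _ => 0
     zero_of_not_mem := fun _ _ => rfl
     additive := fun _ _ _ _ _ => by simp
     bounded := ⟨0, fun _ => by simp⟩ }⟩

namespace Charge

variable {Ω : Type*} {S : Set (Set Ω)}

/-- The charge `B ↦ μ (B \ C)`. -/
noncomputable def restrictCompl (hS : MeasureTheory.IsSetAlgebra S) (μ : Charge S)
    (C : Set Ω) (hC : C ∈ S) : Charge S := by
  classical
  exact
    { toFun := fun B => if B ∈ S then μ.toFun (B \ C) else 0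
      zero_of_not_mem := fun B hB => if_neg hB
      additive := fun A B hA hB hAB => by
        simp only [if_pos hA, if_pos hB, if_pos (hS.union_mem hA hB)]
        rw [Set.union_sdiff_distrib]
        exact μ.additive _ _ (hS.sdiff_mem hA hC) (hS.sdiff_mem hB hC)
          (hAB.mono Set.sdiff_subset Set.sdiff_subset)
      bounded := by
        obtain ⟨K, hK⟩ := μ.bounded
        refine ⟨K, fun B => ?_⟩
        split_ifs
        · exact hK _
        · rw [abs_zero]
          exact (abs_nonneg _).trans (hK ∅) }

theorem restrictCompl_toFun (hS : MeasureTheory.IsSetAlgebra S) (μ : Charge S)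
    {C : Set Ω} (hC : C ∈ S) {B : Set Ω} (hB : B ∈ S) :
    (μ.restrictCompl hS C hC).toFun B = μ.toFun (B \ C) :=
  if_pos hB

/-- A charge that is nonpositive on all events of small probability under a convex-ranged
probability charge is nonpositive. -/
theorem nonpos_of_nonpos_of_small (hS : MeasureTheory.IsSetAlgebra S) {P : Charge S}
    (hPcr : HasConvexRange P) {c : ℝ} (hc : 0 < c) {ν : Charge S}
    (hν : ∀ C ∈ S, P.toFun C < c → ν.toFun C ≤ 0) : ν ≤ 0 := by
  have key : ∀ n : ℕ, ∀ A ∈ S, P.toFun A ≤ n * (c / 2) → ν.toFun A ≤ 0 := by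
    intro n
    induction n with
    | zero =>
      intro A hA h
      exact hν A hA (by simp at h; linarith)
    | succ n ih =>
      intro A hA h
      by_cases hs : P.toFun A < c
      · exact hν A hA hs
      · have hmem : c / 2 ∈ {x : ℝ | ∃ B ∈ S, B ⊆ A ∧ P.toFun B = x} := by
          rw [hPcr A hA]
          constructor <;> linarith
        obtain ⟨B, hB, hBA, hPB⟩ := hmem
        have h1 := hν B hB (by linarith)
        have h2 := ih (A \ B) (hS.sdiff_mem hA hB) (by
          rw [P.toFun_diff hS hA hB hBA]
          push_cast at h
          linarith)
        rw [ν.toFun_diff hS hA hB hBA] at h2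
        linarith
  intro A hA
  obtain ⟨n, hn⟩ := exists_nat_ge (P.toFun A / (c / 2))
  exact key n A hA ((div_le_iff₀ (by linarith)).1 hn)

/-- If `P C < c`, the charge `B ↦ P (B \ C) / (c - P C)` dominates the indicator game of
`{P > c}`. -/
theorem smul_restrictCompl_mem_looseCore (hS : MeasureTheory.IsSetAlgebra S) {P : Charge S}
    (hP : IsProbCharge P) {c : ℝ} {C : Set Ω} (hC : C ∈ S) (hPC : P.toFun C < c) :
    (c - P.toFun C)⁻¹ • P.restrictCompl hS C hC ∈
      LooseCore (fun A => if c < P.toFun A then (1 : ℝ) else 0) := by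
  intro A hA
  have hpos : 0 < c - P.toFun C := sub_pos.2 hPC
  rw [smul_toFun, restrictCompl_toFun hS P hC hA]
  dsimp only
  split_ifs with h
  · have h1 := P.toFun_diff hS hA (hS.inter_mem hA hC) Set.inter_subset_left
    have h2 := P.toFun_diff hS hC (hS.inter_mem hA hC) Set.inter_subset_right
    have h3 := hP.2 (C \ (A ∩ C))
    rw [Set.sdiff_self_inter] at h1
    rw [inv_mul_eq_div, one_le_div hpos]
    linarith
  · exact mul_nonneg (inv_nonneg.2 hpos.le) (hP.2 _)

end Charge

/-- For the Value-at-Risk game `v_γ(A) = 1` if `P(A) > 1 − γ`, `0`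
otherwise, associated with a convex-ranged probability charge `P` and `γ ∈ (0,1)`, both the
supremum of the loose anticore and the infimum of the loose core exist in `ba` (setwise
order) and are equal to the zero charge. -/
theorem stmt12 {Ω : Type*} (S : Set (Set Ω)) (hS : MeasureTheory.IsSetAlgebra S)
    (P : Charge S) (hP : IsProbCharge P) (hPcr : HasConvexRange P)
    (γ : ℝ) (hγ : γ ∈ Set.Ioo (0 : ℝ) 1) :
    IsLUB (LooseAnticore (fun A => if 1 - γ < P.toFun A then (1 : ℝ) else 0) :
        Set (Charge S)) (0 : Charge S) ∧
    IsGLB (LooseCore (fun A => if 1 - γ < P.toFun A then (1 : ℝ) else 0) :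
        Set (Charge S)) (0 : Charge S) := by
  have hc : 0 < 1 - γ := by linarith [hγ.2]
  have hv : ∀ A : Set Ω, (0 : ℝ) ≤ if 1 - γ < P.toFun A then (1 : ℝ) else 0 := fun A => by
    split_ifs <;> norm_num
  refine ⟨⟨fun μ hμ => ?_, fun ν hν => hν fun A _ => hv A⟩,
    fun μ hμ A hA => (hv A).trans (hμ A hA), fun ν hν => ?_⟩
  · exact Charge.nonpos_of_nonpos_of_small hS hPcr hc fun C hC hPC =>
      (hμ C hC).trans_eq (if_neg hPC.not_gt)
  · refine Charge.nonpos_of_nonpos_of_small hS hPcr hc fun C hC hPC => ?_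
    have h := hν (Charge.smul_restrictCompl_mem_looseCore hS hP hC hPC) C hC
    have hempty : P.toFun ∅ = 0 := by
      simpa using P.toFun_diff hS hC hC subset_rfl
    rwa [Charge.smul_toFun, Charge.restrictCompl_toFun hS P hC hC, Set.sdiff_self, hempty,
      mul_zero] at h
end

section
/- Let P be a convex-ranged probability charge on an algebra Σ, let γ ∈ (0, 1/2], and define the game v : Σ → [0,1] by v(A) = sup{2^{−t} : t ∈ ℕ₀, P(A) ≥ 2^{−t}·γ} if P(A) > 0 and v(A) = 0 if P(A) = 0. Then inf LC_v exists in ba (setwise order) and inf LC_v = (1/γ)·P. Consequently, writing μ* = inf LC_v, the reference probability is P = μ*(Ω)^{−1}·μ* and the level is γ = 1/μ*(Ω). -/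
/-- The game `v(A) = sup{2^{−t} : t ∈ ℕ, P(A) ≥ 2^{−t}·γ}` for `P(A) > 0`, and `v(A) = 0`
for `P(A) = 0`. -/
noncomputable def vSmallGamma {Ω : Type*} {S : Set (Set Ω)} (P : Charge S) (γ : ℝ) :
    Set Ω → ℝ := fun A =>
  if 0 < P.toFun A then
    sSup {x : ℝ | ∃ t : ℕ, x = (2 : ℝ) ^ (-(t : ℤ)) ∧ (2 : ℝ) ^ (-(t : ℤ)) * γ ≤ P.toFun A}
  else 0

/-- If `μ ≥ 0` is at least `d` on every set of `P`-mass `c`, then `μ` is at least `n * d` on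
every set of `P`-mass at least `n * c`. -/
theorem HasConvexRange.nat_mul_le {Ω : Type*} {S : Set (Set Ω)}
    (hS : MeasureTheory.IsSetAlgebra S) {P μ : Charge S} (hPcr : HasConvexRange P)
    (hμ : ∀ A ∈ S, 0 ≤ μ.toFun A) {c d : ℝ} (hc : 0 ≤ c)
    (hcd : ∀ B ∈ S, P.toFun B = c → d ≤ μ.toFun B) (n : ℕ) :
    ∀ A ∈ S, n * c ≤ P.toFun A → n * d ≤ μ.toFun A := by
  induction n with
  | zero => intro A hA _; simpa using hμ A hA
  | succ n ih =>
    intro A hA h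
    push_cast at h ⊢
    have hmem : c ∈ Set.Icc 0 (P.toFun A) :=
      ⟨hc, by nlinarith [mul_nonneg n.cast_nonneg hc]⟩
    rw [← hPcr A hA] at hmem
    obtain ⟨B, hB, hBA, hPB⟩ := hmem
    have hdiff : A \ B ∈ S := hS.sdiff_mem hA hB
    have hPA := P.additive B (A \ B) hB hdiff Set.disjoint_sdiff_right
    have hμA := μ.additive B (A \ B) hB hdiff Set.disjoint_sdiff_right
    rw [Set.union_sdiff_cancel hBA] at hPA hμA
    have := ih (A \ B) hdiff (by linarith)
    have := hcd B hB hPB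
    linarith

theorem le_vSmallGamma {Ω : Type*} {S : Set (Set Ω)} {P : Charge S} {γ : ℝ} {A : Set Ω}
    (hA : 0 < P.toFun A) {t : ℕ} (ht : (2 : ℝ) ^ (-(t : ℤ)) * γ ≤ P.toFun A) :
    (2 : ℝ) ^ (-(t : ℤ)) ≤ vSmallGamma P γ A := by
  rw [vSmallGamma, if_pos hA]
  refine le_csSup ⟨1, ?_⟩ ⟨t, rfl, ht⟩
  rintro x ⟨s, rfl, -⟩
  exact zpow_le_one_of_nonpos₀ one_le_two (by simp)

theorem vSmallGamma_nonneg {Ω : Type*} {S : Set (Set Ω)} (P : Charge S) (γ : ℝ) (A : Set Ω) :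
    0 ≤ vSmallGamma P γ A := by
  unfold vSmallGamma
  split_ifs
  · refine Real.sSup_nonneg ?_
    rintro x ⟨t, rfl, -⟩
    positivity
  · rfl

theorem smul_mem_looseCore {Ω : Type*} {S : Set (Set Ω)} {P : Charge S}
    (hP : ∀ A, 0 ≤ P.toFun A) {γ : ℝ} (hγ : 0 < γ) :
    γ⁻¹ • P ∈ (LooseCore (vSmallGamma P γ) : Set (Charge S)) := by
  intro A _
  have hnn : 0 ≤ γ⁻¹ * P.toFun A := mul_nonneg (inv_nonneg.2 hγ.le) (hP A)
  rw [Charge.smul_toFun, vSmallGamma]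
  split_ifs
  · refine Real.sSup_le ?_ hnn
    rintro x ⟨t, rfl, ht⟩
    rwa [le_inv_mul_iff₀ hγ, mul_comm]
  · exact hnn

theorem smul_le_of_mem_looseCore {Ω : Type*} {S : Set (Set Ω)}
    (hS : MeasureTheory.IsSetAlgebra S) {P μ : Charge S} (hP : ∀ A, 0 ≤ P.toFun A)
    (hPcr : HasConvexRange P) {γ : ℝ} (hγ : 0 < γ)
    (hμ : μ ∈ (LooseCore (vSmallGamma P γ) : Set (Charge S))) :
    γ⁻¹ • P ≤ μ := by
  intro A hA
  rw [Charge.smul_toFun]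
  refine le_of_forall_pos_le_add fun ε hε => ?_
  obtain ⟨t, ht⟩ := exists_pow_lt_of_lt_one hε (one_half_lt_one (α := ℝ))
  set d : ℝ := (2 : ℝ) ^ (-(t : ℤ)) with hd
  have hdpos : 0 < d := by positivity
  have hdε : d < ε := by simpa [hd] using ht
  have hc : 0 < d * γ := mul_pos hdpos hγ
  set x : ℝ := γ⁻¹ * P.toFun A with hx
  have hPx : P.toFun A = γ * x := by rw [hx, mul_inv_cancel_left₀ hγ.ne']
  have hx0 : 0 ≤ x := mul_nonneg (inv_nonneg.2 hγ.le) (hP A)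
  have hfloor : (⌊x / d⌋₊ : ℝ) * d ≤ x :=
    (le_div_iff₀ hdpos).1 (Nat.floor_le (div_nonneg hx0 hdpos.le))
  have hlt : x < (⌊x / d⌋₊ + 1) * d := (div_lt_iff₀ hdpos).1 (Nat.lt_floor_add_one _)
  have key := hPcr.nat_mul_le hS (fun B hB => (vSmallGamma_nonneg P γ B).trans (hμ B hB)) hc.le
    (fun B hB hPB => (le_vSmallGamma (hPB ▸ hc) hPB.ge).trans (hμ B hB)) ⌊x / d⌋₊ A hA
    (by rw [hPx]; nlinarith)
  linarith

/-- For a convex-ranged probability charge `P` on an algebra `S` and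
`γ ∈ (0, 1/2]`, the infimum of the loose core of the game `v` above exists in `ba`
(setwise order) and equals `(1/γ)·P`; consequently, writing `μ* = inf LC_v`, one recovers
`P = μ*(Ω)⁻¹·μ*` and `γ = 1/μ*(Ω)`. -/
theorem stmt15 {Ω : Type*} (S : Set (Set Ω)) (hS : MeasureTheory.IsSetAlgebra S)
    (P : Charge S) (hP : IsProbCharge P) (hPcr : HasConvexRange P)
    (γ : ℝ) (hγ : γ ∈ Set.Ioc (0 : ℝ) (1 / 2)) :
    IsGLB (LooseCore (vSmallGamma P γ) : Set (Charge S)) (γ⁻¹ • P) ∧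
    ∀ μstar : Charge S, IsGLB (LooseCore (vSmallGamma P γ) : Set (Charge S)) μstar →
      P = (μstar.toFun Set.univ)⁻¹ • μstar ∧ γ = (μstar.toFun Set.univ)⁻¹ := by
  obtain ⟨hP1, hP0⟩ := hP
  have hglb : IsGLB (LooseCore (vSmallGamma P γ) : Set (Charge S)) (γ⁻¹ • P) :=
    IsLeast.isGLB ⟨smul_mem_looseCore hP0 hγ.1,
      fun _ hμ => smul_le_of_mem_looseCore hS hP0 hPcr hγ.1 hμ⟩
  refine ⟨hglb, fun μstar hμ => ?_⟩
  obtain rfl := hμ.unique hglb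
  have hγ0 : γ ≠ 0 := hγ.1.ne'
  refine ⟨Charge.ext' (funext fun A => ?_), by simp [hP1]⟩
  simp [hP1, hγ0]
end

section
/- Let Σ be a σ-algebra, ℙ an atomless probability measure on Σ, and μ a finite countably additive signed measure on Σ with μ ≪ ℙ (i.e., ℙ(N) = 0 implies μ(N) = 0). Define ρ_μ on the space B(Σ) of bounded Σ-measurable random variables by ρ_μ(X) = sup{ ∫ Y dμ : Y ∈ B(Σ), Y ∼_ℙ X }. Then ρ_μ is real-valued, subadditive (ρ_μ(X + Y) ≤ ρ_μ(X) + ρ_μ(Y)), positively homogeneous (ρ_μ(tX) = t·ρ_μ(X) for t ≥ 0), ℙ-invariant (X ∼_ℙ Y implies ρ_μ(X) = ρ_μ(Y)), and continuous with respect to the supremum norm; in fact |ρ_μ(X) − ρ_μ(Y)| ≤ |μ|(Ω)·‖X − Y‖_∞ for all X, Y ∈ B(Σ). -/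
open MeasureTheory

/-- The integral of a bounded random variable with respect to a finite signed measure,
via the Jordan decomposition. -/
noncomputable def signedIntegral {Ω : Type*} [MeasurableSpace Ω]
    (μ : SignedMeasure Ω) (X : Ω → ℝ) : ℝ :=
  (∫ ω, X ω ∂μ.toJordanDecomposition.posPart) - ∫ ω, X ω ∂μ.toJordanDecomposition.negPart

/-- A bounded measurable random variable. -/
def IsBddRV {Ω : Type*} [MeasurableSpace Ω] (X : Ω → ℝ) : Prop :=
  Measurable X ∧ ∃ C : ℝ, ∀ ω, |X ω| ≤ C

/-- `ρ_μ(X) = sup {∫ Y dμ : Y bounded measurable, Y ∼_P X}`. -/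
noncomputable def rhoMu {Ω : Type*} [MeasurableSpace Ω]
    (P : Measure Ω) (μ : SignedMeasure Ω) (X : Ω → ℝ) : ℝ :=
  sSup {r : ℝ | ∃ Y : Ω → ℝ, IsBddRV Y ∧ P.map Y = P.map X ∧ r = signedIntegral μ Y}

open Set Filter Topology ProbabilityTheory
open scoped ENNReal unitInterval

section Atomless

variable {Ω : Type*} [MeasurableSpace Ω]

/-- Every event of positive measure contains a subevent of strictly smaller positive measure. -/
def IsAtomless (P : Measure Ω) : Prop :=
  ∀ A : Set Ω, MeasurableSet A → 0 < P A →
    ∃ B : Set Ω, MeasurableSet B ∧ B ⊆ A ∧ 0 < P B ∧ P B < P A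

/-- A chain of events, strictly increasing in probability, that cannot be refined. -/
structure IsSaturatedChain (P : Measure Ω) (M : Set (Set Ω)) : Prop where
  meas : ∀ A ∈ M, MeasurableSet A
  mono : ∀ A ∈ M, ∀ B ∈ M, P.real A ≤ P.real B → A ⊆ B
  empty_mem : ∅ ∈ M
  univ_mem : univ ∈ M
  sat : ∀ L, MeasurableSet L → (∀ B ∈ M, P.real B ≠ P.real L) →
    (∀ B ∈ M, P.real B < P.real L → B ⊆ L) → (∀ B ∈ M, P.real L < P.real B → L ⊆ B) → False

theorem exists_isSaturatedChain (P : Measure Ω) [IsProbabilityMeasure P] :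
    ∃ M, IsSaturatedChain P M := by
  let r : Set Ω → Set Ω → Prop := fun A B =>
    MeasurableSet A ∧ MeasurableSet B ∧ A ⊆ B ∧ P.real A < P.real B
  have hr : r ∅ univ := ⟨.empty, .univ, empty_subset _, by simp⟩
  have hc : IsChain r {∅, univ} := by
    rintro A (rfl | rfl) B (rfl | rfl) hAB
    · exact absurd rfl hAB
    · exact Or.inl hr
    · exact Or.inr hr
    · exact absurd rfl hAB
  obtain ⟨M, hM, hcM⟩ := hc.exists_maxChain
  have h0 : ∅ ∈ M := hcM (by simp)
  have hmeas : ∀ A ∈ M, MeasurableSet A := fun A hA => by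
    by_cases h : A = ∅
    · exact h ▸ .empty
    · rcases hM.1 hA h0 h with h | h
      exacts [h.1, h.2.1]
  refine ⟨M, hmeas, fun A hA B hB hAB => ?_, h0, hcM (by simp), fun L hL hne hlt hgt => ?_⟩
  · by_cases h : A = B
    · exact h.subset
    · rcases hM.1 hA hB h with h | h
      exacts [h.2.2.1, absurd h.2.2.2 hAB.not_gt]
  · have hLM : IsChain r (insert L M) := hM.1.insert fun B hB _ => by
      rcases (hne B hB).lt_or_gt with h | h
      · exact Or.inr ⟨hmeas B hB, hL, hlt B hB h, h⟩
      · exact Or.inl ⟨hL, hmeas B hB, hgt B hB h, h⟩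
    have : L ∈ M := hM.2 hLM (subset_insert _ _) ▸ mem_insert _ _
    exact hne L this rfl

variable {P : Measure Ω} [IsProbabilityMeasure P] {M : Set (Set Ω)}

namespace IsSaturatedChain

theorem compl (hM : IsSaturatedChain P M) : IsSaturatedChain P {A | Aᶜ ∈ M} where
  meas A hA := (hM.meas _ hA).of_compl
  mono A hA B hB h := by
    have h1 := probReal_compl_eq_one_sub (μ := P) (hM.meas _ hA).of_compl
    have h2 := probReal_compl_eq_one_sub (μ := P) (hM.meas _ hB).of_compl
    exact compl_subset_compl.1 (hM.mono _ hB _ hA (by linarith))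
  empty_mem := by simpa using hM.univ_mem
  univ_mem := by simpa using hM.empty_mem
  sat L hL hne hlt hgt := by
    have hL' := probReal_compl_eq_one_sub (μ := P) hL
    have key : ∀ B ∈ M, P.real Bᶜ = 1 - P.real B := fun B hB =>
      probReal_compl_eq_one_sub (hM.meas B hB)
    refine hM.sat Lᶜ hL.compl (fun B hB h => ?_) (fun B hB h => ?_) (fun B hB h => ?_)
    · exact hne Bᶜ (by simpa using hB) (by rw [key B hB]; linarith)
    · exact subset_compl_comm.1 (hgt Bᶜ (by simpa using hB) (by rw [key B hB]; linarith))
    · exact compl_subset_comm.1 (hlt Bᶜ (by simpa using hB) (by rw [key B hB]; linarith))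

theorem exists_max_le (hM : IsSaturatedChain P M) {t : ℝ} (ht : 0 ≤ t) :
    ∃ L ∈ M, P.real L ≤ t ∧ ∀ B ∈ M, P.real B ≤ t → P.real B ≤ P.real L := by
  let S : Set ℝ := P.real '' {B | B ∈ M ∧ P.real B ≤ t}
  have hS : S.Nonempty := ⟨_, ∅, ⟨hM.empty_mem, by simpa using ht⟩, rfl⟩
  have hSt : ∀ x ∈ S, x ≤ t := by rintro _ ⟨B, hB, rfl⟩; exact hB.2
  have hSb : BddAbove S := ⟨t, hSt⟩
  have hle : ∀ B ∈ M, P.real B ≤ t → P.real B ≤ sSup S := fun B hB h =>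
    le_csSup hSb ⟨B, ⟨hB, h⟩, rfl⟩
  by_cases hex : ∃ L ∈ M, P.real L = sSup S
  · obtain ⟨L, hL, hLS⟩ := hex
    exact ⟨L, hL, hLS ▸ csSup_le hS hSt, fun B hB h => hLS ▸ hle B hB h⟩
  push Not at hex
  obtain ⟨u, hu, hlim, hmem⟩ := exists_seq_tendsto_sSup hS hSb
  choose B hB hBu using hmem
  have hmono : Monotone B := fun m n hmn =>
    hM.mono _ (hB m).1 _ (hB n).1 (by rw [hBu, hBu]; exact hu hmn)
  have hL : P.real (⋃ n, B n) = sSup S := by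
    have h1 := tendsto_measure_iUnion_atTop (μ := P) hmono
    have h2 := (ENNReal.tendsto_toReal (measure_ne_top P (⋃ n, B n))).comp h1
    refine tendsto_nhds_unique h2 (hlim.congr fun n => (hBu n).symm)
  refine (hM.sat (⋃ n, B n) (.iUnion fun n => hM.meas _ (hB n).1)
    (fun A hA => hL ▸ hex A hA) (fun A hA h => ?_) (fun A hA h => ?_)).elim
  · obtain ⟨n, hn⟩ := (hlim.eventually (lt_mem_nhds (hL ▸ h))).exists
    exact (hM.mono A hA _ (hB n).1 (by rw [hBu]; exact hn.le)).trans (subset_iUnion B n)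
  · refine iUnion_subset fun n => hM.mono _ (hB n).1 A hA ?_
    exact (hle _ (hB n).1 (hB n).2).trans (hL ▸ h.le)

theorem exists_min_ge (hM : IsSaturatedChain P M) {t : ℝ} (ht : t ≤ 1) :
    ∃ R ∈ M, t ≤ P.real R ∧ ∀ B ∈ M, t ≤ P.real B → P.real R ≤ P.real B := by
  obtain ⟨L, hL, hLt, hmax⟩ := hM.compl.exists_max_le (t := 1 - t) (by linarith)
  have hLc := probReal_compl_eq_one_sub (μ := P) (hM.compl.meas L hL)
  refine ⟨Lᶜ, hL, by linarith, fun B hB h => ?_⟩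
  have hBc := probReal_compl_eq_one_sub (μ := P) (hM.meas B hB)
  have := hmax Bᶜ (by simpa using hB) (by linarith)
  linarith

theorem exists_measureReal_eq (hM : IsSaturatedChain P M) (hP : IsAtomless P)
    {t : ℝ} (h0 : 0 ≤ t) (h1 : t ≤ 1) : ∃ B ∈ M, P.real B = t := by
  obtain ⟨L, hL, hLt, hmax⟩ := hM.exists_max_le h0
  obtain ⟨R, hR, hRt, hmin⟩ := hM.exists_min_ge h1
  by_contra! hne
  have hLt' := lt_of_le_of_ne hLt (hne L hL)
  have hRt' := lt_of_le_of_ne hRt (hne R hR).symm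
  have hLR : L ⊆ R := hM.mono L hL R hR (by linarith)
  have hdiff : P.real (R \ L) = P.real R - P.real L := measureReal_sdiff hLR (hM.meas L hL)
  obtain ⟨D, hD, hDRL, hD0, hDlt⟩ := hP (R \ L) ((hM.meas R hR).diff (hM.meas L hL))
    (ENNReal.toReal_pos_iff.1 (show 0 < P.real (R \ L) by linarith)).1
  have hD0' : 0 < P.real D := ENNReal.toReal_pos hD0.ne' (measure_ne_top P D)
  have hDlt' : P.real D < P.real (R \ L) :=
    (ENNReal.toReal_lt_toReal (measure_ne_top P _) (measure_ne_top P _)).2 hDlt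
  have hE : P.real (L ∪ D) = P.real L + P.real D :=
    measureReal_union (disjoint_sdiff_right.mono_right hDRL) hD
  have hER : L ∪ D ⊆ R := union_subset hLR (hDRL.trans sdiff_subset)
  have hdich : ∀ B ∈ M, P.real B ≤ P.real L ∨ P.real R ≤ P.real B := fun B hB =>
    (le_total (P.real B) t).imp (hmax B hB) (hmin B hB)
  refine hM.sat (L ∪ D) ((hM.meas L hL).union hD) (fun B hB h => ?_) (fun B hB h => ?_)
    (fun B hB h => ?_)
  · rcases hdich B hB with h' | h' <;> linarith
  · rcases hdich B hB with h' | h'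
    · exact (hM.mono B hB L hL h').trans subset_union_left
    · linarith
  · rcases hdich B hB with h' | h'
    · linarith
    · exact hER.trans (hM.mono R hR B hB h')

end IsSaturatedChain

theorem IsAtomless.exists_uniform (hP : IsAtomless P) :
    ∃ U : Ω → I, Measurable U ∧ P.map U = volume := by
  obtain ⟨M, hM⟩ := exists_isSaturatedChain P
  choose B hBM hB using fun t : I => hM.exists_measureReal_eq hP t.2.1 t.2.2
  have hmono : ∀ s t : I, s ≤ t → B s ⊆ B t := fun s t h =>
    hM.mono _ (hBM s) _ (hBM t) (by rw [hB, hB]; exact h)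
  have hmeas : ∀ t, MeasurableSet (B t) := fun t => hM.meas _ (hBM t)
  let q : ℕ → I := TopologicalSpace.denseSeq I
  have hq : ∀ a b : I, a < b → ∃ n, a < q n ∧ q n < b := fun a b h => by
    obtain ⟨_, ⟨n, rfl⟩, hn⟩ := (TopologicalSpace.denseRange_denseSeq I).exists_between h
    exact ⟨n, hn⟩
  classical
  let U : Ω → I := fun ω => ⨅ n, if ω ∈ B (q n) then q n else 1
  have hU : Measurable U := .iInf fun n => .ite (hmeas _) measurable_const measurable_const
  have hlt : ∀ x, U ⁻¹' Iio x = ⋃ n, ⋃ _ : q n < x, B (q n) := fun x => by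
    ext ω
    simp only [mem_preimage, mem_Iio, mem_iUnion, U, iInf_lt_iff]
    refine exists_congr fun n => ?_
    split_ifs with h
    · simp [h]
    · simp [h, unitInterval.le_one']
  have hreal : ∀ x : I, P.real (U ⁻¹' Iio x) = x := fun x => by
    apply le_antisymm
    · rw [← hB x]
      refine measureReal_mono ?_
      rw [hlt]
      exact iUnion₂_subset fun n hn => hmono _ _ hn.le
    · refine le_of_forall_lt fun c hc => ?_
      by_cases hc0 : c < 0
      · exact hc0.trans_le measureReal_nonneg
      · obtain ⟨n, hn, hnx⟩ := hq ⟨c, not_lt.1 hc0, hc.le.trans x.2.2⟩ x hc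
        refine lt_of_lt_of_le (show c < (q n : ℝ) from hn) ?_
        rw [← hB (q n)]
        refine measureReal_mono ?_
        rw [hlt]
        exact subset_iUnion₂_of_subset n hnx Subset.rfl
  have := Measure.isProbabilityMeasure_map (μ := P) hU.aemeasurable
  refine ⟨U, hU, Measure.ext_of_Ici _ _ fun a => ?_⟩
  have h1 : (Ici a) = (Iio a)ᶜ := by simp
  rw [Measure.map_apply hU measurableSet_Ici, unitInterval.volume_Ici,
    h1, preimage_compl, ← ofReal_measureReal, probReal_compl_eq_one_sub (hU measurableSet_Iio),
    hreal]

theorem IsAtomless.cond (hP : IsAtomless P) {A : Set Ω} (hA : MeasurableSet A) (h0 : P A ≠ 0) :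
    IsAtomless P[|A] := fun S hS hpos => by
  simp only [cond_apply hA] at hpos ⊢
  have hi0 : (P A)⁻¹ ≠ 0 := ENNReal.inv_ne_zero.2 (measure_ne_top P A)
  have hit : (P A)⁻¹ ≠ ∞ := ENNReal.inv_ne_top.2 h0
  obtain ⟨B, hB, hBS, hB0, hBlt⟩ := hP (A ∩ S) (hA.inter hS)
    (pos_of_ne_zero (right_ne_zero_of_mul hpos.ne'))
  have hAB : A ∩ B = B := inter_eq_right.2 (hBS.trans inter_subset_left)
  refine ⟨B, hB, hBS.trans inter_subset_right, ?_, ?_⟩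
  · rw [hAB]
    exact ENNReal.mul_pos hi0 hB0.ne'
  · rw [hAB]
    exact (ENNReal.mul_lt_mul_iff_right hi0 hit).2 hBlt

variable {E : Type*} [MeasurableSpace E] [StandardBorelSpace E]

theorem IsAtomless.exists_map_restrict_eq [Nonempty E] (hP : IsAtomless P) {A : Set Ω}
    (hA : MeasurableSet A) (ν : Measure E) (hν : ν univ = P A) :
    ∃ f : Ω → E, Measurable f ∧ (P.restrict A).map f = ν := by
  by_cases h0 : P A = 0
  · refine ⟨fun _ => Classical.arbitrary E, measurable_const, ?_⟩
    rw [Measure.restrict_eq_zero.2 h0, Measure.map_zero,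
      Measure.measure_univ_eq_zero.1 (hν.trans h0)]
  have ht := measure_ne_top P A
  have := cond_isProbabilityMeasure h0
  have : IsProbabilityMeasure ((P A)⁻¹ • ν) :=
    ⟨by rw [Measure.smul_apply, hν, smul_eq_mul, ENNReal.inv_mul_cancel h0 ht]⟩
  obtain ⟨U, hU, hUmap⟩ := (hP.cond hA h0).exists_uniform
  obtain ⟨g, hg, hgmap⟩ := ((P A)⁻¹ • ν).exists_measurable_map_eq
  refine ⟨g ∘ U, hg.comp hU, ?_⟩
  have h1 : (P[|A]).map (g ∘ U) = (P A)⁻¹ • ν := by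
    rw [← Measure.map_map hg hU, hUmap, hgmap]
  have h2 : P.restrict A = P A • P[|A] := by
    rw [ProbabilityTheory.cond, smul_smul, ENNReal.mul_inv_cancel h0 ht, one_smul]
  rw [h2, Measure.map_smul, h1, smul_smul, ENNReal.mul_inv_cancel h0 ht, one_smul]

theorem sum_restrict_preimage_singleton {F ι : Type*} [MeasurableSpace F] [MeasurableSpace ι]
    [Countable ι] [MeasurableSingletonClass ι] (m : Measure F) {K : F → ι} (hK : Measurable K) :
    Measure.sum (fun k => m.restrict (K ⁻¹' {k})) = m := by
  rw [← Measure.restrict_iUnion (fun i j hij => by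
      rw [Function.onFun, disjoint_left]; rintro ω rfl h; exact hij h)
    (fun k => hK (measurableSet_singleton k)), ← preimage_iUnion, iUnion_of_singleton,
    preimage_univ, Measure.restrict_univ]

theorem IsAtomless.exists_map_eq_and_comp_eq {ι : Type*} [MeasurableSpace ι]
    [Countable ι] [MeasurableSingletonClass ι] (hP : IsAtomless P)
    {W : Ω → E} (hW : Measurable W) {H : E → ι} (hH : Measurable H)
    {K : Ω → ι} (hK : Measurable K) (hKH : P.map K = P.map (H ∘ W)) :
    ∃ W' : Ω → E, Measurable W' ∧ P.map W' = P.map W ∧ ∀ᵐ ω ∂P, H (W' ω) = K ω := by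
  obtain ⟨ω₀⟩ := nonempty_of_isProbabilityMeasure P
  have : Nonempty E := ⟨W ω₀⟩
  have hKm : ∀ k, MeasurableSet (K ⁻¹' {k}) := fun k => hK (measurableSet_singleton k)
  have hHm : ∀ k, MeasurableSet (H ⁻¹' {k}) := fun k => hH (measurableSet_singleton k)
  choose f hf hfmap using fun k => hP.exists_map_restrict_eq (hKm k)
    ((P.map W).restrict (H ⁻¹' {k})) (by
      rw [Measure.restrict_apply_univ, Measure.map_apply hW (hHm k), ← preimage_comp,
        ← Measure.map_apply (hH.comp hW) (measurableSet_singleton k), ← hKH,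
        Measure.map_apply hK (measurableSet_singleton k)])
  have hW' : Measurable fun ω => f (K ω) ω :=
    (measurable_from_prod_countable_right (f := fun p : ι × Ω => f p.1 p.2) hf).comp
      (hK.prodMk measurable_id)
  have hae : ∀ k, (fun ω => f (K ω) ω) =ᵐ[P.restrict (K ⁻¹' {k})] f k := fun k => by
    filter_upwards [ae_restrict_mem (hKm k)] with ω hω
    rw [show K ω = k from hω]
  refine ⟨_, hW', ?_, ?_⟩
  · conv_lhs => rw [← sum_restrict_preimage_singleton P hK]
    rw [Measure.map_sum hW'.aemeasurable, ← sum_restrict_preimage_singleton (P.map W) hH]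
    congr with k : 1
    rw [Measure.map_congr (hae k), hfmap]
  · rw [← sum_restrict_preimage_singleton P hK, Measure.ae_sum_iff]
    intro k
    have h : ∀ᵐ y ∂(P.restrict (K ⁻¹' {k})).map (f k), H y = k := by
      rw [hfmap]
      exact ae_restrict_mem (hHm k)
    filter_upwards [hae k, ae_of_ae_map (hf k).aemeasurable h, ae_restrict_mem (hKm k)]
      with ω h1 h2 h3
    rw [h1, h2]
    exact (show K ω = k from h3).symm

theorem IsAtomless.exists_map_eq_and_abs_sub_le (hP : IsAtomless P)
    {W : Ω → E} (hW : Measurable W) {φ : E → ℝ} (hφ : Measurable φ)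
    {Z : Ω → ℝ} (hZ : Measurable Z) (hZW : P.map Z = P.map (φ ∘ W)) {ε : ℝ} (hε : 0 < ε) :
    ∃ W' : Ω → E, Measurable W' ∧ P.map W' = P.map W ∧ ∀ᵐ ω ∂P, |φ (W' ω) - Z ω| ≤ ε := by
  have hfl : Measurable fun x : ℝ => ⌊x / ε⌋ := Int.measurable_floor.comp (measurable_id.div_const ε)
  obtain ⟨W', hW', hmap, hae⟩ := hP.exists_map_eq_and_comp_eq hW (hfl.comp hφ) (hfl.comp hZ) (by
    rw [← Measure.map_map hfl hZ, hZW, Measure.map_map hfl (hφ.comp hW)]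
    rfl)
  refine ⟨W', hW', hmap, ?_⟩
  filter_upwards [hae] with ω hω
  have h := Int.abs_sub_lt_one_of_floor_eq_floor hω
  rw [← sub_div, abs_div, abs_of_pos hε, div_lt_one hε] at h
  exact h.le

end Atomless

section SignedIntegral

variable {Ω : Type*} [MeasurableSpace Ω] {P : Measure Ω} {μ : SignedMeasure Ω} {X Y Z : Ω → ℝ}

theorem IsBddRV.integrable (hX : IsBddRV X) (m : Measure Ω) [IsFiniteMeasure m] :
    Integrable X m := by
  obtain ⟨hm, C, hC⟩ := hX
  exact .of_bound hm.aestronglyMeasurable C (ae_of_all _ hC)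

theorem IsBddRV.add (hX : IsBddRV X) (hY : IsBddRV Y) : IsBddRV (X + Y) := by
  obtain ⟨hm, C, hC⟩ := hX
  obtain ⟨hm', C', hC'⟩ := hY
  exact ⟨hm.add hm', C + C', fun ω => (abs_add_le _ _).trans (add_le_add (hC ω) (hC' ω))⟩

theorem IsBddRV.const_mul (hX : IsBddRV X) (t : ℝ) : IsBddRV fun ω => t * X ω := by
  obtain ⟨hm, C, hC⟩ := hX
  refine ⟨hm.const_mul t, |t| * C, fun ω => ?_⟩
  rw [abs_mul]
  exact mul_le_mul_of_nonneg_left (hC ω) (abs_nonneg t)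

theorem IsBddRV.sub (hX : IsBddRV X) (hY : IsBddRV Y) : IsBddRV (X - Y) := by
  simpa [sub_eq_add_neg, Pi.neg_def] using hX.add (hY.const_mul (-1))

theorem signedIntegral_add (hX : IsBddRV X) (hY : IsBddRV Y) :
    signedIntegral μ (X + Y) = signedIntegral μ X + signedIntegral μ Y := by
  simp only [signedIntegral, Pi.add_apply]
  rw [integral_add (hX.integrable _) (hY.integrable _),
    integral_add (hX.integrable _) (hY.integrable _)]
  ring

theorem signedIntegral_sub (hX : IsBddRV X) (hY : IsBddRV Y) :
    signedIntegral μ (X - Y) = signedIntegral μ X - signedIntegral μ Y := by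
  simp only [signedIntegral, Pi.sub_apply]
  rw [integral_sub (hX.integrable _) (hY.integrable _),
    integral_sub (hX.integrable _) (hY.integrable _)]
  ring

theorem signedIntegral_const_mul (t : ℝ) :
    signedIntegral μ (fun ω => t * X ω) = t * signedIntegral μ X := by
  simp only [signedIntegral, integral_const_mul]
  ring

theorem totalVariation_absolutelyContinuous_of_null [IsFiniteMeasure P]
    (hac : ∀ N : Set Ω, MeasurableSet N → P N = 0 → μ N = 0) : μ.totalVariation ≪ P := by
  have h : μ ≪ᵥ P.toENNRealVectorMeasure := .mk fun N hN hPN => hac N hN (by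
    rwa [Measure.toENNRealVectorMeasure_apply_measurable hN] at hPN)
  simpa [SignedMeasure.absolutelyContinuous_ennreal_iff,
    Measure.toENNRealVectorMeasure_ennrealToMeasure] using h

theorem abs_signedIntegral_le (hac : μ.totalVariation ≪ P) {c : ℝ}
    (hX : ∀ᵐ ω ∂P, |X ω| ≤ c) :
    |signedIntegral μ X| ≤ (μ.totalVariation univ).toReal * c := by
  obtain ⟨hpos, hneg⟩ := (SignedMeasure.totalVariation_absolutelyContinuous_iff μ P).1 hac
  have h1 : |∫ ω, X ω ∂μ.toJordanDecomposition.posPart| ≤ _ :=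
    norm_integral_le_of_norm_le_const (f := X) (hpos.ae_le hX)
  have h2 : |∫ ω, X ω ∂μ.toJordanDecomposition.negPart| ≤ _ :=
    norm_integral_le_of_norm_le_const (f := X) (hneg.ae_le hX)
  have h3 : (μ.totalVariation univ).toReal = μ.toJordanDecomposition.posPart.real univ +
      μ.toJordanDecomposition.negPart.real univ := by
    rw [SignedMeasure.totalVariation, ← measureReal_def, measureReal_add_apply]
  rw [h3, signedIntegral]
  refine (abs_sub _ _).trans ((add_le_add h1 h2).trans_eq ?_)
  ring

theorem signedIntegral_le_add (hac : μ.totalVariation ≪ P) (hX : IsBddRV X) (hY : IsBddRV Y)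
    {c : ℝ} (h : ∀ᵐ ω ∂P, |Y ω - X ω| ≤ c) :
    signedIntegral μ X ≤ signedIntegral μ Y + (μ.totalVariation univ).toReal * c := by
  have := neg_le_of_abs_le (abs_signedIntegral_le (X := Y - X) hac h)
  rw [signedIntegral_sub hY hX] at this
  linarith

theorem ae_abs_le_of_map_eq {E : Type*} [MeasurableSpace E] {V W : Ω → E} (hV : Measurable V)
    (hW : Measurable W) (h : P.map W = P.map V) {φ : E → ℝ} (hφ : Measurable φ) {c : ℝ}
    (hc : ∀ ω, |φ (V ω)| ≤ c) : ∀ᵐ ω ∂P, |φ (W ω)| ≤ c := by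
  refine ae_of_ae_map (p := fun y => |φ y| ≤ c) hW.aemeasurable ?_
  rw [h, ae_map_iff hV.aemeasurable (measurableSet_le (by fun_prop) measurable_const)]
  exact ae_of_all _ hc

/-- A random variable with the law of a bounded one has a bounded version. -/
theorem IsBddRV.exists_ae_eq (hX : IsBddRV X) (hY : Measurable Y) (h : P.map Y = P.map X) :
    ∃ Y', IsBddRV Y' ∧ Y' =ᵐ[P] Y := by
  obtain ⟨hm, C, hC⟩ := hX
  have hae : ∀ᵐ ω ∂P, |Y ω| ≤ C := ae_abs_le_of_map_eq hm hY h measurable_id hC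
  refine ⟨fun ω => max (-|C|) (min |C| (Y ω)), ⟨by fun_prop, |C|, fun ω => ?_⟩, ?_⟩
  · exact abs_le.2 ⟨le_max_left _ _, max_le (by linarith [abs_nonneg C]) (min_le_left _ _)⟩
  · filter_upwards [hae] with ω hω
    obtain ⟨h1, h2⟩ := abs_le.1 (hω.trans (le_abs_self C))
    rw [min_eq_right h2, max_eq_right h1]

theorem IsAtomless.exists_coupling [IsProbabilityMeasure P] (hP : IsAtomless P) (hX : IsBddRV X)
    (hY : IsBddRV Y) {φ : ℝ × ℝ → ℝ} (hφ : Measurable φ) (hZ : Measurable Z)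
    (hmap : P.map Z = P.map fun ω => φ (X ω, Y ω)) {ε : ℝ} (hε : 0 < ε) :
    ∃ X' Y', IsBddRV X' ∧ IsBddRV Y' ∧
      P.map (fun ω => (X' ω, Y' ω)) = P.map (fun ω => (X ω, Y ω)) ∧
      ∀ᵐ ω ∂P, |φ (X' ω, Y' ω) - Z ω| ≤ ε := by
  have hW : Measurable fun ω => (X ω, Y ω) := hX.1.prodMk hY.1
  obtain ⟨W, hWm, hWmap, hWae⟩ := hP.exists_map_eq_and_abs_sub_le hW hφ hZ hmap hε
  obtain ⟨X', hX', hXae⟩ := hX.exists_ae_eq (P := P) hWm.fst (by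
    have := congrArg (Measure.map Prod.fst) hWmap
    rwa [Measure.map_map measurable_fst hWm, Measure.map_map measurable_fst hW] at this)
  obtain ⟨Y', hY', hYae⟩ := hY.exists_ae_eq (P := P) hWm.snd (by
    have := congrArg (Measure.map Prod.snd) hWmap
    rwa [Measure.map_map measurable_snd hWm, Measure.map_map measurable_snd hW] at this)
  have hae : (fun ω => (X' ω, Y' ω)) =ᵐ[P] W := hXae.prodMk hYae
  refine ⟨X', Y', hX', hY', (Measure.map_congr hae).trans hWmap, ?_⟩
  filter_upwards [hae, hWae] with ω h1 h2
  rwa [h1]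

theorem map_fst_eq_and_map_snd_eq {X' Y' : Ω → ℝ} (hX : Measurable X) (hY : Measurable Y)
    (hX' : Measurable X') (hY' : Measurable Y')
    (h : P.map (fun ω => (X' ω, Y' ω)) = P.map (fun ω => (X ω, Y ω))) :
    P.map X' = P.map X ∧ P.map Y' = P.map Y := by
  have h1 := congrArg (Measure.map Prod.fst) h
  have h2 := congrArg (Measure.map Prod.snd) h
  rw [Measure.map_map measurable_fst (hX'.prodMk hY'),
    Measure.map_map measurable_fst (hX.prodMk hY)] at h1
  rw [Measure.map_map measurable_snd (hX'.prodMk hY'),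
    Measure.map_map measurable_snd (hX.prodMk hY)] at h2
  exact ⟨h1, h2⟩

/-- The integrals of the bounded rearrangements of `X`. -/
def rearrangementIntegrals (P : Measure Ω) (μ : SignedMeasure Ω) (X : Ω → ℝ) : Set ℝ :=
  {r : ℝ | ∃ Y : Ω → ℝ, IsBddRV Y ∧ P.map Y = P.map X ∧ r = signedIntegral μ Y}

theorem rearrangementIntegrals_nonempty (hX : IsBddRV X) :
    (rearrangementIntegrals P μ X).Nonempty := ⟨_, X, hX, rfl, rfl⟩

theorem rearrangementIntegrals_bddAbove (hac : μ.totalVariation ≪ P) (hX : IsBddRV X) :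
    BddAbove (rearrangementIntegrals P μ X) := by
  obtain ⟨hm, C, hC⟩ := hX
  refine ⟨(μ.totalVariation univ).toReal * C, ?_⟩
  rintro _ ⟨Y, hY, hmap, rfl⟩
  exact (le_abs_self _).trans
    (abs_signedIntegral_le hac (ae_abs_le_of_map_eq hm hY.1 hmap measurable_id hC))

theorem signedIntegral_le_rhoMu (hac : μ.totalVariation ≪ P) (hX : IsBddRV X) (hY : IsBddRV Y)
    (h : P.map Y = P.map X) : signedIntegral μ Y ≤ rhoMu P μ X :=
  le_csSup (rearrangementIntegrals_bddAbove hac hX) ⟨Y, hY, h, rfl⟩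

theorem rhoMu_le (hX : IsBddRV X) {a : ℝ}
    (h : ∀ Y, IsBddRV Y → P.map Y = P.map X → signedIntegral μ Y ≤ a) : rhoMu P μ X ≤ a :=
  csSup_le (rearrangementIntegrals_nonempty hX) (by rintro _ ⟨Y, hY, hmap, rfl⟩; exact h Y hY hmap)

theorem rhoMu_congr (h : P.map X = P.map Y) : rhoMu P μ X = rhoMu P μ Y := by
  rw [rhoMu, rhoMu, h]

theorem rhoMu_const_mul_le (hac : μ.totalVariation ≪ P) (hX : IsBddRV X) {t : ℝ} (ht : 0 < t) :
    rhoMu P μ (fun ω => t * X ω) ≤ t * rhoMu P μ X := by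
  refine rhoMu_le (hX.const_mul t) fun Z hZ hmap => ?_
  have hm : Measurable fun x : ℝ => t⁻¹ * x := measurable_const_mul _
  have h := signedIntegral_le_rhoMu (μ := μ) hac hX (hZ.const_mul t⁻¹) (by
    have := congrArg (Measure.map fun x : ℝ => t⁻¹ * x) hmap
    rw [Measure.map_map hm hZ.1, Measure.map_map hm (hX.const_mul t).1] at this
    simpa [Function.comp_def, ht.ne'] using this)
  rwa [signedIntegral_const_mul, inv_mul_le_iff₀ ht] at h

theorem rhoMu_zero (hac : μ.totalVariation ≪ P) : rhoMu P μ (fun _ => 0) = 0 := by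
  have h0 : IsBddRV fun _ : Ω => (0 : ℝ) := ⟨measurable_const, 0, by simp⟩
  apply le_antisymm
  · refine rhoMu_le h0 fun Z hZ hmap => ?_
    exact (le_abs_self _).trans ((abs_signedIntegral_le (c := 0) hac
      (ae_abs_le_of_map_eq h0.1 hZ.1 hmap measurable_id (by simp))).trans (by simp))
  · simpa [signedIntegral] using signedIntegral_le_rhoMu (μ := μ) hac h0 h0 rfl

theorem rhoMu_const_mul (hac : μ.totalVariation ≪ P) (hX : IsBddRV X) {t : ℝ} (ht : 0 ≤ t) :
    rhoMu P μ (fun ω => t * X ω) = t * rhoMu P μ X := by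
  rcases ht.eq_or_lt with rfl | ht
  · simpa using rhoMu_zero hac
  · refine le_antisymm (rhoMu_const_mul_le hac hX ht) ?_
    have h := rhoMu_const_mul_le hac (hX.const_mul t) (inv_pos.2 ht)
    simp only [inv_mul_cancel_left₀ ht.ne'] at h
    rwa [le_inv_mul_iff₀ ht] at h

theorem le_of_forall_pos_le_add_mul {a b c : ℝ} (hc : 0 ≤ c)
    (h : ∀ ε > 0, a ≤ b + c * ε) : a ≤ b := by
  refine le_of_forall_pos_le_add fun δ hδ => (h (δ / (c + 1)) (by positivity)).trans ?_
  have : c * (δ / (c + 1)) ≤ δ := by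
    rw [mul_div_assoc', div_le_iff₀ (by positivity)]
    nlinarith
  linarith

variable [IsProbabilityMeasure P]

theorem rhoMu_add_le (hP : IsAtomless P) (hac : μ.totalVariation ≪ P) (hX : IsBddRV X)
    (hY : IsBddRV Y) : rhoMu P μ (X + Y) ≤ rhoMu P μ X + rhoMu P μ Y := by
  refine rhoMu_le (hX.add hY) fun Z hZ hmap => ?_
  refine le_of_forall_pos_le_add_mul (c := (μ.totalVariation univ).toReal)
    ENNReal.toReal_nonneg fun ε hε => ?_
  obtain ⟨X', Y', hX', hY', hlaw, hae⟩ := hP.exists_coupling hX hY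
    (measurable_fst.add measurable_snd) hZ.1 hmap hε
  obtain ⟨h1, h2⟩ := map_fst_eq_and_map_snd_eq hX.1 hY.1 hX'.1 hY'.1 hlaw
  refine (signedIntegral_le_add hac hZ (hX'.add hY') hae).trans ?_
  rw [signedIntegral_add hX' hY']
  gcongr
  exacts [signedIntegral_le_rhoMu hac hX hX' h1, signedIntegral_le_rhoMu hac hY hY' h2]

theorem rhoMu_sub_le (hP : IsAtomless P) (hac : μ.totalVariation ≪ P) (hX : IsBddRV X)
    (hY : IsBddRV Y) {c : ℝ} (hc : ∀ ω, |X ω - Y ω| ≤ c) :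
    rhoMu P μ X - rhoMu P μ Y ≤ (μ.totalVariation univ).toReal * c := by
  rw [sub_le_iff_le_add']
  refine rhoMu_le hX fun Z hZ hmap => ?_
  refine le_of_forall_pos_le_add_mul (c := (μ.totalVariation univ).toReal)
    ENNReal.toReal_nonneg fun ε hε => ?_
  obtain ⟨X', Y', hX', hY', hlaw, hae⟩ := hP.exists_coupling hX hY measurable_fst hZ.1 hmap hε
  obtain ⟨-, h2⟩ := map_fst_eq_and_map_snd_eq hX.1 hY.1 hX'.1 hY'.1 hlaw
  have hXY : ∀ᵐ ω ∂P, |X' ω - Y' ω| ≤ c :=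
    ae_abs_le_of_map_eq (hX.1.prodMk hY.1) (hX'.1.prodMk hY'.1) hlaw
      (measurable_fst.sub measurable_snd) hc
  refine (signedIntegral_le_add hac hZ hY' (c := c + ε) ?_).trans ?_
  · filter_upwards [hae, hXY] with ω h h'
    rw [abs_sub_comm] at h'
    exact (abs_sub_le _ (X' ω) _).trans (add_le_add h' h)
  · linarith [signedIntegral_le_rhoMu hac hY hY' h2]

end SignedIntegral

/-- Let `P` be an atomless probability measure and `μ` a finite signed
measure with `μ ≪ P`. Then `ρ_μ` is real-valued (the defining set is nonempty and bounded
above on bounded measurable `X`), subadditive, positively homogeneous, `P`-invariant, and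
Lipschitz with respect to the supremum norm with constant `|μ|(Ω)`. -/
theorem stmt18 {Ω : Type*} [MeasurableSpace Ω] (P : Measure Ω) [IsProbabilityMeasure P]
    (hatomless : ∀ A : Set Ω, MeasurableSet A → 0 < P A →
      ∃ B : Set Ω, MeasurableSet B ∧ B ⊆ A ∧ 0 < P B ∧ P B < P A)
    (μ : SignedMeasure Ω)
    (hac : ∀ N : Set Ω, MeasurableSet N → P N = 0 → μ N = 0) :
    (∀ X : Ω → ℝ, IsBddRV X →
      {r : ℝ | ∃ Y : Ω → ℝ, IsBddRV Y ∧ P.map Y = P.map X ∧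
        r = signedIntegral μ Y}.Nonempty ∧
      BddAbove {r : ℝ | ∃ Y : Ω → ℝ, IsBddRV Y ∧ P.map Y = P.map X ∧
        r = signedIntegral μ Y}) ∧
    (∀ X Y : Ω → ℝ, IsBddRV X → IsBddRV Y →
      rhoMu P μ (X + Y) ≤ rhoMu P μ X + rhoMu P μ Y) ∧
    (∀ X : Ω → ℝ, IsBddRV X → ∀ t : ℝ, 0 ≤ t →
      rhoMu P μ (fun ω => t * X ω) = t * rhoMu P μ X) ∧
    (∀ X Y : Ω → ℝ, IsBddRV X → IsBddRV Y → P.map X = P.map Y →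
      rhoMu P μ X = rhoMu P μ Y) ∧
    (∀ X Y : Ω → ℝ, IsBddRV X → IsBddRV Y →
      |rhoMu P μ X - rhoMu P μ Y| ≤
        (μ.totalVariation Set.univ).toReal * ⨆ ω, |X ω - Y ω|) := by
  have hac' : μ.totalVariation ≪ P := totalVariation_absolutelyContinuous_of_null hac
  refine ⟨fun X hX => ⟨rearrangementIntegrals_nonempty hX, rearrangementIntegrals_bddAbove hac' hX⟩,
    fun X Y hX hY => rhoMu_add_le hatomless hac' hX hY, fun X hX t ht => rhoMu_const_mul hac' hX ht,
    fun X Y _ _ h => rhoMu_congr h, fun X Y hX hY => ?_⟩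
  obtain ⟨-, C, hC⟩ := hX.sub hY
  have hle : ∀ ω, |X ω - Y ω| ≤ ⨆ ω, |X ω - Y ω| := fun ω =>
    le_ciSup (f := fun ω => |X ω - Y ω|) ⟨C, by rintro _ ⟨ω, rfl⟩; exact hC ω⟩ ω
  refine abs_sub_le_iff.2 ⟨rhoMu_sub_le hatomless hac' hX hY hle,
    rhoMu_sub_le hatomless hac' hY hX fun ω => ?_⟩
  rw [abs_sub_comm]
  exact hle ω
end
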